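/- There exists a function f : ℕ × ℕ → ℕ such that the following holds. Let FH be a Frobenius group with cyclic kernel F and complement H, acting by automorphisms on a finite group G in such a manner that C_G(F) = 1 and C_G(H) has exponent dividing e. Then the exponent of G is at most f(e, |FH|). -/

import Mathlib

namespace FrobExp

section Kreknin

variable {K L : Type*} [Field K] [LieRing L] [LieAlgebra K L] {n : ℕ} [NeZero n]

/-- The derived family of a family of subspaces indexed by `ZMod n`. -/
def brFam (V : ZMod n → Submodule K L) (i : ZMod n) : Submodule K L :=
  Submodule.span K {z | ∃ a b : ZMod n, ∃ x y : L, a + b = i ∧ x ∈ V a ∧ y ∈ V b ∧ ⁅x, y⁆ = z}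

/-- Homogeneous elements generated by components with index at least `k`. -/
inductive Gen (V : ZMod n → Submodule K L) (k : ℕ) : ZMod n → L → Prop
  | base (i : ZMod n) (x : L) : k ≤ i.val → x ∈ V i → Gen V k i x
  | zero (i : ZMod n) : Gen V k i 0
  | add (i : ZMod n) (x y : L) : Gen V k i x → Gen V k i y → Gen V k i (x + y)
  | smul (i : ZMod n) (c : K) (x : L) : Gen V k i x → Gen V k i (c • x)
  | lie (i j : ZMod n) (x y : L) : Gen V k i x → Gen V k j y → Gen V k (i + j) ⁅x, y⁆

/-- A family is graded if it is closed under brackets and its zero component vanishes. -/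
structure GrFam (V : ZMod n → Submodule K L) : Prop where
  lie_mem : ∀ a b x y, x ∈ V a → y ∈ V b → ⁅x, y⁆ ∈ V (a + b)
  zero_eq : V 0 = ⊥

lemma GrFam.brFam_le {V : ZMod n → Submodule K L} (hV : GrFam V) (i : ZMod n) :
    brFam V i ≤ V i := by
  unfold brFam
  rw [Submodule.span_le]
  rintro z ⟨a, b, x, y, rfl, hx, hy, rfl⟩
  exact hV.lie_mem _ _ _ _ hx hy

lemma GrFam.brFam {V : ZMod n → Submodule K L} (hV : GrFam V) : GrFam (brFam V) := by
  refine ⟨fun a b x y hx hy => ?_, ?_⟩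
  · exact Submodule.subset_span ⟨a, b, x, y, rfl, hV.brFam_le _ hx, hV.brFam_le _ hy, rfl⟩
  · have := hV.brFam_le 0
    rw [hV.zero_eq] at this
    exact le_bot_iff.mp this

lemma GrFam.iterate {V : ZMod n → Submodule K L} (hV : GrFam V) (s : ℕ) :
    GrFam (FrobExp.brFam^[s] V) ∧ ∀ i, (FrobExp.brFam^[s] V) i ≤ V i := by
  induction s with
  | zero => exact ⟨hV, fun i => le_rfl⟩
  | succ s ih =>
    rw [Function.iterate_succ_apply']
    exact ⟨ih.1.brFam, fun i => (ih.1.brFam_le i).trans (ih.2 i)⟩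

lemma Gen.mono {V M : ZMod n → Submodule K L} {k k' : ℕ}
    (h : ∀ i x, k ≤ i.val → x ∈ M i → Gen V k' i x) {i : ZMod n} {x : L} (hx : Gen M k i x) :
    Gen V k' i x := by
  induction hx with
  | base i x h1 h2 => exact h i x h1 h2
  | zero i => exact Gen.zero i
  | add i x y _ _ h1 h2 => exact Gen.add i x y h1 h2
  | smul i c x _ h1 => exact Gen.smul i c x h1
  | lie i j x y _ _ h1 h2 => exact Gen.lie i j x y h1 h2

lemma Gen.mem {V : ZMod n → Submodule K L} (hV : GrFam V) {k : ℕ} {i : ZMod n} {x : L}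
    (hx : Gen V k i x) : x ∈ V i := by
  induction hx with
  | base i x h1 h2 => exact h2
  | zero i => exact zero_mem _
  | add i x y _ _ h1 h2 => exact add_mem h1 h2
  | smul i c x _ h1 => exact Submodule.smul_mem _ _ h1
  | lie i j x y _ _ h1 h2 => exact hV.lie_mem _ _ _ _ h1 h2

/-- Span of brackets `[z,y]` of total weight `m` with `y` of weight at least `k`. -/
def Qfam (V : ZMod n → Submodule K L) (k : ℕ) (m : ZMod n) : Submodule K L :=
  Submodule.span K {w | ∃ a t : ZMod n, ∃ z y : L, a + t = m ∧ k ≤ t.val ∧ z ∈ V a ∧ y ∈ V t ∧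
    ⁅z, y⁆ = w}

lemma lie_mem_Qfam {V : ZMod n → Submodule K L} (hV : GrFam V) {k : ℕ} {i : ZMod n} {u : L}
    (hu : Gen V k i u) : ∀ (j : ZMod n) (v : L), v ∈ V j → ⁅v, u⁆ ∈ Qfam V k (j + i) := by
  induction hu with
  | base i x h1 h2 => exact fun j v hv => Submodule.subset_span ⟨j, i, v, x, rfl, h1, hv, h2, rfl⟩
  | zero i => intro j v hv; rw [lie_zero]; exact zero_mem _
  | add i x y _ _ h1 h2 => intro j v hv; rw [lie_add]; exact add_mem (h1 j v hv) (h2 j v hv)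
  | smul i c x _ h1 => intro j v hv; rw [lie_smul]; exact Submodule.smul_mem _ _ (h1 j v hv)
  | lie i j x y hx hy h1 h2 =>
    intro l v hv
    have e : ⁅v, ⁅x, y⁆⁆ = ⁅⁅v, x⁆, y⁆ - ⁅⁅v, y⁆, x⁆ := by
      rw [leibniz_lie v x y, ← lie_skew x ⁅v, y⁆]; abel
    rw [e]
    have a1 := h2 (l + i) ⁅v, x⁆ (hV.lie_mem _ _ _ _ hv (hx.mem hV))
    have a2 := h1 (l + j) ⁅v, y⁆ (hV.lie_mem _ _ _ _ hv (hy.mem hV))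
    rw [add_assoc] at a1
    rw [add_assoc, add_comm j i] at a2
    exact sub_mem a1 a2

lemma Qfam_gen {V : ZMod n → Submodule K L} (hV : GrFam V) {k : ℕ} {m : ZMod n}
    (hm : m.val = k) {w : L} (hw : w ∈ Qfam V k m) : Gen V (k + 1) m w := by
  induction hw using Submodule.span_induction with
  | mem w hw =>
    obtain ⟨a, t, z, y, rfl, ht, hz, hy, rfl⟩ := hw
    rcases eq_or_lt_of_le ht with h | h
    · have : a + t = t := ZMod.val_injective n (by omega)
      have ha : a = 0 := by simpa using this
      subst ha
      rw [hV.zero_eq, Submodule.mem_bot] at hz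
      rw [hz, zero_lie]; exact Gen.zero _
    · refine Gen.lie _ _ _ _ (Gen.base _ _ ?_ hz) (Gen.base _ _ h hy)
      have h3 := ZMod.val_add a t
      have h4 := ZMod.val_lt a
      have h5 := ZMod.val_lt t
      rcases lt_or_ge (a.val + t.val) n with h6 | h6
      · rw [Nat.mod_eq_of_lt h6] at h3; omega
      · rw [Nat.mod_eq_sub_mod h6, Nat.mod_eq_of_lt (by omega)] at h3; omega
  | zero => exact Gen.zero _
  | add x y _ _ h1 h2 => exact Gen.add _ _ _ h1 h2
  | smul c x _ h => exact Gen.smul _ _ _ h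

theorem kreknin_aux (k : ℕ) : ∀ (V : ZMod n → Submodule K L), GrFam V → ∀ i x,
    x ∈ (brFam^[2 ^ k - 1] V) i → Gen V (k + 1) i x := by
  induction k with
  | zero =>
    intro V hV i x hx
    simp only [pow_zero, Nat.sub_self, Function.iterate_zero, id] at hx
    by_cases h : i = 0
    · subst h
      rw [hV.zero_eq, Submodule.mem_bot] at hx
      rw [hx]; exact Gen.zero _
    · refine Gen.base _ _ ?_ hx
      have : i.val ≠ 0 := by rwa [Ne, ZMod.val_eq_zero]
      omega
  | succ k ih =>
    intro V hV i x hx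
    have e : 2 ^ (k + 1) - 1 = (2 ^ k - 1) + (2 ^ k - 1 + 1) := by
      have : 0 < 2 ^ k := by positivity
      rw [pow_succ]; omega
    rw [e, Function.iterate_add_apply] at hx
    have h1 := ih _ (hV.iterate (2 ^ k - 1 + 1)).1 i x hx
    refine h1.mono ?_
    intro t y ht hy
    rcases eq_or_lt_of_le ht with h | h
    · rw [Function.iterate_succ_apply'] at hy
      unfold brFam at hy
      induction hy using Submodule.span_induction with
      | mem w hw =>
        obtain ⟨a, b, z, y, rfl, hz, hy, rfl⟩ := hw
        have := lie_mem_Qfam hV (ih V hV b y hy) a z ((hV.iterate _).2 _ hz)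
        exact Qfam_gen hV h.symm this
      | zero => exact Gen.zero _
      | add x y _ _ h1 h2 => exact Gen.add _ _ _ h1 h2
      | smul c x _ h => exact Gen.smul _ _ _ h
    · exact Gen.base _ _ h ((hV.iterate _).2 _ hy)

/-- **Kreknin's theorem** in family form. -/
theorem kreknin (V : ZMod n → Submodule K L) (hV : GrFam V) (m : ℕ) (hm : n ≤ m) (i : ZMod n) :
    (brFam^[2 ^ m - 1] V) i = ⊥ := by
  rw [Submodule.eq_bot_iff]
  intro x hx
  have h := kreknin_aux m V hV i x hx
  clear hx
  induction h with
  | base i x h1 h2 => have := ZMod.val_lt i; omega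
  | zero i => rfl
  | add i x y _ _ h1 h2 => rw [h1, h2, add_zero]
  | smul i c x _ h1 => rw [h1, smul_zero]
  | lie i j x y _ _ h1 h2 => rw [h1, zero_lie]

end Kreknin

end FrobExp

namespace FrobExp

section Assoc

variable {K : Type*} [Field K]

lemma comm_nil {R : Type*} [Ring R] [Algebra K R] (N : ℕ) (J : Submodule K R) (B : Finset R)
    (hJl : ∀ b ∈ B, ∀ x ∈ J, b * x ∈ J) (hJr : ∀ b ∈ B, ∀ x ∈ J, x * b ∈ J)
    (hc : ∀ b ∈ B, ∀ c ∈ B, b * c - c * b ∈ J) (hn : ∀ b ∈ B, b ^ N ∈ J) :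
    (Submodule.span K (B : Set R)) ^ (B.card * N + 1) ≤ J := by
  classical
  induction B using Finset.induction_on with
  | empty => simp
  | insert b B hb ih =>
    have ih := ih (fun c h => hJl c (Finset.mem_insert_of_mem h))
      (fun c h => hJr c (Finset.mem_insert_of_mem h))
      (fun c h c' h' => hc c (Finset.mem_insert_of_mem h) c' (Finset.mem_insert_of_mem h'))
      (fun c h => hn c (Finset.mem_insert_of_mem h))
    set U := Submodule.span K (B : Set R) with hU
    set P := Submodule.span K ({b} : Set R) with hP
    have hPU : Submodule.span K ((insert b B : Finset R) : Set R) = P + U := by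
      rw [Finset.coe_insert, Submodule.span_insert, Submodule.add_eq_sup]
    have bB : b ∈ insert b B := Finset.mem_insert_self _ _
    have PJ : P * J ≤ J := by
      rw [Submodule.mul_le]
      intro x hx y hy
      obtain ⟨c, rfl⟩ := Submodule.mem_span_singleton.mp hx
      rw [smul_mul_assoc]
      exact Submodule.smul_mem _ _ (hJl b bB y hy)
    have JP : J * P ≤ J := by
      rw [Submodule.mul_le]
      intro y hy x hx
      obtain ⟨c, rfl⟩ := Submodule.mem_span_singleton.mp hx
      rw [mul_smul_comm]
      exact Submodule.smul_mem _ _ (hJr b bB y hy)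
    have UJ : U * J ≤ J := by
      rw [Submodule.mul_le]
      intro x hx y hy
      induction hx using Submodule.span_induction with
      | mem x hx => exact hJl x (Finset.mem_insert_of_mem hx) y hy
      | zero => rw [zero_mul]; exact zero_mem _
      | add x z _ _ h1 h2 => rw [add_mul]; exact add_mem h1 h2
      | smul c x _ h => rw [smul_mul_assoc]; exact Submodule.smul_mem _ _ h
    have JU : J * U ≤ J := by
      rw [Submodule.mul_le]
      intro y hy x hx
      induction hx using Submodule.span_induction with
      | mem x hx => exact hJr x (Finset.mem_insert_of_mem hx) y hy
      | zero => rw [mul_zero]; exact zero_mem _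
      | add x z _ _ h1 h2 => rw [mul_add]; exact add_mem h1 h2
      | smul c x _ h => rw [mul_smul_comm]; exact Submodule.smul_mem _ _ h
    have PkJ : ∀ k : ℕ, P ^ k * J ≤ J := by
      intro k
      induction k with
      | zero => simp
      | succ k ihk => rw [pow_succ, mul_assoc]; exact (mul_le_mul_right PJ _).trans ihk
    have UkJ : ∀ k : ℕ, U ^ k * J ≤ J := by
      intro k
      induction k with
      | zero => simp
      | succ k ihk => rw [pow_succ, mul_assoc]; exact (mul_le_mul_right UJ _).trans ihk
    have JPk : ∀ k : ℕ, J * P ^ k ≤ J := by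
      intro k
      induction k with
      | zero => simp
      | succ k ihk => rw [pow_succ, ← mul_assoc]; exact (mul_le_mul_left ihk _).trans JP
    have JSk : ∀ k : ℕ, J * (P + U) ^ k ≤ J := by
      intro k
      induction k with
      | zero => simp
      | succ k ihk =>
        rw [pow_succ, ← mul_assoc]
        refine (mul_le_mul_left ihk _).trans ?_
        rw [mul_add]
        exact sup_le JP JU
    have PU1 : P * U ≤ U * P + J := by
      rw [Submodule.mul_le]
      intro x hx y hy
      obtain ⟨c, rfl⟩ := Submodule.mem_span_singleton.mp hx
      rw [smul_mul_assoc]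
      refine Submodule.smul_mem _ _ ?_
      induction hy using Submodule.span_induction with
      | mem y hy =>
        have : b * y = y * b + (b * y - y * b) := by abel
        rw [this]
        exact Submodule.add_mem_sup (Submodule.mul_mem_mul (Submodule.subset_span hy)
          (Submodule.mem_span_singleton_self b)) (hc b bB y (Finset.mem_insert_of_mem hy))
      | zero => rw [mul_zero]; exact zero_mem _
      | add x z _ _ h1 h2 => rw [mul_add]; exact add_mem h1 h2
      | smul c x _ h => rw [mul_smul_comm]; exact Submodule.smul_mem _ _ h
    have PUk : ∀ k : ℕ, P ^ k * U ≤ U * P ^ k + J := by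
      intro k
      induction k with
      | zero => simp
      | succ k ihk =>
        calc P ^ (k + 1) * U = P ^ k * (P * U) := by rw [pow_succ, mul_assoc]
          _ ≤ P ^ k * (U * P + J) := mul_le_mul_right PU1 _
          _ = (P ^ k * U) * P + P ^ k * J := by rw [mul_add, mul_assoc]
          _ ≤ (U * P ^ k + J) * P + J := add_le_add (mul_le_mul_left ihk _) (PkJ k)
          _ = U * P ^ (k + 1) + (J * P + J) := by rw [add_mul, pow_succ, mul_assoc, add_assoc]
          _ ≤ U * P ^ (k + 1) + J := by
            refine add_le_add le_rfl ?_
            exact sup_le JP le_rfl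
    have PN : P ^ N ≤ J := by
      rw [hP, Submodule.span_pow, Submodule.span_le]
      simp only [Set.singleton_pow, Set.singleton_subset_iff]
      exact hn b bB
    have key : ∀ k a c : ℕ, B.card * N + 1 + N ≤ a + c + k →
        U ^ a * P ^ c * (P + U) ^ k ≤ J := by
      intro k
      induction k with
      | zero =>
        intro a c h
        rw [pow_zero, mul_one]
        rcases le_or_gt N c with h1 | h1
        · obtain ⟨c', rfl⟩ := Nat.exists_eq_add_of_le h1
          refine le_trans (mul_le_mul_right ?_ _) (UkJ a)
          rw [pow_add]
          exact (mul_le_mul_left PN _).trans (JPk _)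
        · obtain ⟨a', rfl⟩ := Nat.exists_eq_add_of_le (show B.card * N + 1 ≤ a by omega)
          refine le_trans (mul_le_mul_left ?_ _) (JPk c)
          rw [add_comm, pow_add]
          exact (mul_le_mul_right ih _).trans (UkJ _)
      | succ k ihk =>
        intro a c h
        calc U ^ a * P ^ c * (P + U) ^ (k + 1)
            = U ^ a * P ^ (c + 1) * (P + U) ^ k + U ^ a * (P ^ c * U) * (P + U) ^ k := by
              rw [pow_succ' (P + U), pow_succ P]; simp only [mul_add, add_mul, mul_assoc]
          _ ≤ J + U ^ a * (U * P ^ c + J) * (P + U) ^ k := by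
              refine add_le_add (ihk _ _ (by omega)) ?_
              exact mul_le_mul_left (mul_le_mul_right (PUk c) _) _
          _ = J + (U ^ (a + 1) * P ^ c * (P + U) ^ k + U ^ a * J * (P + U) ^ k) := by
              rw [pow_succ U]; simp only [mul_add, add_mul, mul_assoc]
          _ ≤ J := by
              refine sup_le le_rfl (sup_le (ihk _ _ (by omega)) ?_)
              exact (mul_le_mul_left (UkJ a) _).trans (JSk k)
    have := key ((insert b B).card * N + 1) 0 0 (by
      rw [Finset.card_insert_of_notMem hb, add_mul]; omega)
    rw [hPU]
    simpa using this

variable {A : Type*} [Ring A] [Algebra K A]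

/-- Bracket of two subspaces of an associative algebra. -/
def br (M N : Submodule K A) : Submodule K A :=
  Submodule.span K {z | ∃ x ∈ M, ∃ y ∈ N, x * y - y * x = z}

lemma mem_br {M N : Submodule K A} {x y : A} (hx : x ∈ M) (hy : y ∈ N) : x * y - y * x ∈ br M N :=
  Submodule.subset_span ⟨x, hx, y, hy, rfl⟩

lemma br_le {M N P : Submodule K A} : br M N ≤ P ↔ ∀ x ∈ M, ∀ y ∈ N, x * y - y * x ∈ P := by
  unfold br
  rw [Submodule.span_le]
  constructor
  · intro h x hx y hy; exact h ⟨x, hx, y, hy, rfl⟩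
  · rintro h z ⟨x, hx, y, hy, rfl⟩; exact h x hx y hy

lemma br_mono {M N M' N' : Submodule K A} (h : M ≤ M') (h' : N ≤ N') : br M N ≤ br M' N' :=
  br_le.mpr fun _ hx _ hy => mem_br (h hx) (h' hy)

lemma pow_step (M : Submodule K A) (hM : br M M ≤ M) (B : Finset A) (hB : ∀ b ∈ B, b ∈ M) (N c : ℕ)
    (hN : ∀ b ∈ B, b ^ N = 0) (hs : M ≤ Submodule.span K (B : Set A) ⊔ br M M)
    (hc : (br M M) ^ c = ⊥) : M ^ ((B.card * N + 1) * c) = ⊥ := by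
  set D := br M M with hD
  set S : Submodule K A := Subalgebra.toSubmodule (Algebra.adjoin K (M : Set A)) with hS
  have SS : S * S = S := (Algebra.adjoin K (M : Set A)).isIdempotentElem_toSubmodule
  have MS : M ≤ S := fun x hx => Algebra.subset_adjoin hx
  have oneS : (1 : A) ∈ S := one_mem (Algebra.adjoin K (M : Set A))
  have DS : D ≤ S := hM.trans MS
  have DleSD : D ≤ S * D := fun x hx => by simpa using Submodule.mul_mem_mul oneS hx
  have MSD : M * (S * D) ≤ S * D := by
    rw [← mul_assoc]
    exact mul_le_mul_left ((mul_le_mul_left MS _).trans SS.le) _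
  have DA : D * S ≤ S * D := by
    have : ∀ a ∈ Algebra.adjoin K (M : Set A), ∀ y ∈ D, y * a ∈ S * D := by
      intro a ha
      induction ha using Algebra.adjoin_induction with
      | mem m hm =>
        intro y hy
        have e : y * m = m * y + (y * m - m * y) := by abel
        rw [e]
        exact add_mem (Submodule.mul_mem_mul (MS hm) hy) (DleSD (mem_br (hM hy) hm))
      | algebraMap r =>
        intro y hy
        rw [← Algebra.commutes, ← Algebra.smul_def]
        exact Submodule.smul_mem _ _ (DleSD hy)
      | add a b _ _ h1 h2 => intro y hy; rw [mul_add]; exact add_mem (h1 y hy) (h2 y hy)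
      | mul a b _ _ h1 h2 =>
        intro y hy
        rw [← mul_assoc]
        have h3 := h1 y hy
        generalize y * a = w at h3
        induction h3 using Submodule.mul_induction_on' with
        | mem_mul_mem s hs d hd =>
          rw [mul_assoc]
          have := Submodule.mul_mem_mul hs (h2 d hd)
          rwa [← mul_assoc S, SS] at this
        | add x _ y _ h1 h2 => rw [add_mul]; exact add_mem h1 h2
    rw [Submodule.mul_le]
    exact fun y hy a ha => this a ha y hy
  have DrA : ∀ r : ℕ, D ^ r * S ≤ S * D ^ r := by
    intro r
    induction r with
    | zero => simp
    | succ r ih =>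
      calc D ^ (r + 1) * S = D ^ r * (D * S) := by rw [pow_succ, mul_assoc]
        _ ≤ D ^ r * (S * D) := mul_le_mul_right DA _
        _ = (D ^ r * S) * D := by rw [mul_assoc]
        _ ≤ (S * D ^ r) * D := mul_le_mul_left ih _
        _ = S * D ^ (r + 1) := by rw [pow_succ, mul_assoc]
  have SDM : S * D * M ≤ S * D := by
    calc S * D * M ≤ S * D * S := mul_le_mul_right MS _
      _ = S * (D * S) := mul_assoc _ _ _
      _ ≤ S * (S * D) := mul_le_mul_right DA _
      _ = S * D := by rw [← mul_assoc, SS]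
  have hBk : (Submodule.span K (B : Set A)) ^ (B.card * N + 1) ≤ S * D := by
    refine comm_nil N (S * D) B ?_ ?_ ?_ ?_
    · exact fun b hb x hx => MSD (Submodule.mul_mem_mul (hB b hb) hx)
    · exact fun b hb x hx => SDM (Submodule.mul_mem_mul hx (hB b hb))
    · exact fun b hb c hc => DleSD (mem_br (hB b hb) (hB c hc))
    · intro b hb; rw [hN b hb]; exact zero_mem _
  have hspM : Submodule.span K (B : Set A) ≤ M := Submodule.span_le.mpr hB
  have hk : ∀ k : ℕ, M ^ (k + 1) ≤ (Submodule.span K (B : Set A)) ^ (k + 1) + S * D := by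
    intro k
    induction k with
    | zero =>
      rw [zero_add, pow_one, pow_one]
      exact hs.trans (sup_le_sup le_rfl DleSD)
    | succ k ih =>
      calc M ^ (k + 1 + 1) = M ^ (k + 1) * M := pow_succ _ _
        _ ≤ ((Submodule.span K (B : Set A)) ^ (k + 1) + S * D) * M := mul_le_mul_left ih _
        _ = (Submodule.span K (B : Set A)) ^ (k + 1) * M + S * D * M := add_mul _ _ _
        _ ≤ (Submodule.span K (B : Set A)) ^ (k + 1) * (Submodule.span K (B : Set A) + D)
            + S * D := add_le_add (mul_le_mul_right hs _) SDM
        _ ≤ (Submodule.span K (B : Set A)) ^ (k + 1 + 1) + S * D := by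
          rw [mul_add, ← pow_succ, add_assoc]
          refine add_le_add le_rfl (sup_le ?_ le_rfl)
          refine mul_le_mul_left ?_ _
          have h1 : (Submodule.span K (B : Set A)) ≤ S := hspM.trans MS
          have h2 : ∀ j : ℕ, S ^ (j + 1) ≤ S := by
            intro j
            induction j with
            | zero => simp
            | succ j ihj => rw [pow_succ]; exact (mul_le_mul_left ihj _).trans SS.le
          exact (pow_le_pow_left' h1 _).trans (h2 k)
  have hk1 : M ^ (B.card * N + 1) ≤ S * D := (hk _).trans (sup_le hBk le_rfl)
  have fin : ∀ r : ℕ, M ^ ((B.card * N + 1) * r) ≤ S * D ^ r := by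
    intro r
    induction r with
    | zero => simpa using Submodule.one_le.mpr oneS
    | succ r ih =>
      calc M ^ ((B.card * N + 1) * (r + 1)) = M ^ ((B.card * N + 1) * r) * M ^ (B.card * N + 1) := by
            rw [mul_add, mul_one, pow_add]
        _ ≤ (S * D ^ r) * (S * D) := mul_le_mul' ih hk1
        _ = S * (D ^ r * S) * D := by simp only [mul_assoc]
        _ ≤ S * (S * D ^ r) * D := mul_le_mul_left (mul_le_mul_right (DrA r) _) _
        _ = S * D ^ (r + 1) := by rw [pow_succ, ← mul_assoc S S, SS, mul_assoc]
  have := fin c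
  rw [hc, Submodule.mul_bot] at this
  exact le_bot_iff.mp this

end Assoc

end FrobExp

namespace FrobExp

section Assoc2

variable {K : Type*} [Field K] {A : Type*} [Ring A] [Algebra K A]

/-- The adjoint operator. -/
def adm (b : A) : Module.End K A := LinearMap.mulLeft K b - LinearMap.mulRight K b

lemma adm_apply (b x : A) : adm (K := K) b x = b * x - x * b := rfl

lemma adm_pow (b : A) (N : ℕ) (hb : b ^ N = 0) : adm (K := K) b ^ (2 * N) = 0 := by
  unfold adm
  rw [sub_eq_add_neg]
  have h1 : Commute (LinearMap.mulLeft K b) (LinearMap.mulRight K b) :=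
    LinearMap.commute_mulLeft_right (R := K) b b
  refine Commute.add_pow_eq_zero_of_add_le_succ_of_pow_eq_zero (m := N) (n := N) h1.neg_right
    ?_ ?_ (by omega)
  · rw [LinearMap.pow_mulLeft, hb, LinearMap.mulLeft_zero_eq_zero]
  · rw [neg_pow, LinearMap.pow_mulRight, hb, LinearMap.mulRight_zero_eq_zero, mul_zero]

/-- Apply a space of operators to a space of vectors. -/
def app (X : Submodule K (Module.End K A)) (Y : Submodule K A) : Submodule K A :=
  Submodule.map₂ LinearMap.id X Y

lemma app_le {X : Submodule K (Module.End K A)} {Y Z : Submodule K A} :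
    app X Y ≤ Z ↔ ∀ f ∈ X, ∀ y ∈ Y, f y ∈ Z := Submodule.map₂_le

lemma mem_app {X : Submodule K (Module.End K A)} {Y : Submodule K A} {f : Module.End K A} {y : A}
    (hf : f ∈ X) (hy : y ∈ Y) : f y ∈ app X Y := Submodule.apply_mem_map₂ LinearMap.id hf hy

lemma app_mono {X : Submodule K (Module.End K A)} {Y Z : Submodule K A} (h : Y ≤ Z) :
    app X Y ≤ app X Z := app_le.mpr fun _ hf _ hy => mem_app hf (h hy)

lemma app_sup (X : Submodule K (Module.End K A)) (Y Z : Submodule K A) :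
    app X (Y ⊔ Z) = app X Y ⊔ app X Z := Submodule.map₂_sup_right _ _ _ _

lemma app_app_le (X Y : Submodule K (Module.End K A)) (Z : Submodule K A) :
    app X (app Y Z) ≤ app (X * Y) Z := by
  rw [app_le]
  intro f hf
  have : app Y Z ≤ (app (X * Y) Z).comap f := by
    rw [app_le]
    intro g hg z hz
    exact mem_app (f := f * g) (Submodule.mul_mem_mul hf hg) hz
  exact fun y hy => this hy

lemma app_span_finset [DecidableEq A] (B : Finset (Module.End K A)) (S : Finset A) :
    app (Submodule.span K (B : Set (Module.End K A))) (Submodule.span K (S : Set A)) =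
      Submodule.span K ((Finset.image₂ (fun f x => f x) B S : Finset A) : Set A) := by
  unfold app
  rw [Submodule.map₂_span_span]
  simp

/-- bound for the number of generators of the derived subalgebra. -/
def gb (N d : ℕ) : ℕ := ∑ j ∈ Finset.range (d * (2 * N) + 1), d ^ (j + 2)

lemma gen_step (M : Submodule K A) (hM : br M M ≤ M) (B : Finset A) (hB : ∀ b ∈ B, b ∈ M) (N d : ℕ)
    (hN : ∀ b ∈ B, b ^ N = 0) (hs : M ≤ Submodule.span K (B : Set A) ⊔ br M M)
    (hd : B.card ≤ d) :
    ∃ T : Finset A, T.card ≤ gb N d ∧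
      br M M ≤ Submodule.span K (T : Set A) ⊔ br (br M M) (br M M) := by
  classical
  set D := br M M with hD
  set E := br D D with hE
  have hDM : br M D ≤ D := br_mono le_rfl hM
  -- the Lie algebra M normalizes E
  have hME : ∀ x ∈ M, ∀ y ∈ E, x * y - y * x ∈ E := by
    intro x hx
    have : E ≤ E.comap (adm (K := K) x) := by
      rw [hE, br_le]
      intro u hu v hv
      rw [Submodule.mem_comap, adm_apply]
      have e : x * (u * v - v * u) - (u * v - v * u) * x =
          ((x * u - u * x) * v - v * (x * u - u * x)) + (u * (x * v - v * x) - (x * v - v * x) * u) := by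
        noncomm_ring
      rw [e]
      exact add_mem (mem_br (hDM (mem_br hx hu)) hv) (mem_br hu (hDM (mem_br hx hv)))
    exact fun y hy => this hy
  set aB : Finset (Module.End K A) := B.image (adm (K := K)) with haB
  have haBc : aB.card ≤ d := Finset.card_image_le.trans hd
  set W := Submodule.span K (aB : Set (Module.End K A)) with hW
  let J : Submodule K (Module.End K A) :=
    { carrier := {f | ∀ x ∈ D, f x ∈ E}
      add_mem' := fun {f g} hf hg x hx => by
        rw [LinearMap.add_apply]; exact add_mem (hf x hx) (hg x hx)
      zero_mem' := fun x _ => by rw [LinearMap.zero_apply]; exact zero_mem _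
      smul_mem' := fun c f hf x hx => by
        rw [LinearMap.smul_apply]; exact Submodule.smul_mem _ _ (hf x hx) }
  have memJ : ∀ f, f ∈ J ↔ ∀ x ∈ D, f x ∈ E := fun f => Iff.rfl
  have hWJ : W ^ (aB.card * (2 * N) + 1) ≤ J := by
    refine comm_nil (2 * N) J aB ?_ ?_ ?_ ?_
    · intro f hf g hg x hx
      obtain ⟨b, hb, rfl⟩ := Finset.mem_image.mp hf
      rw [Module.End.mul_apply, adm_apply]
      exact hME b (hB b hb) _ (hg x hx)
    · intro f hf g hg x hx
      obtain ⟨b, hb, rfl⟩ := Finset.mem_image.mp hf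
      rw [Module.End.mul_apply]
      exact hg _ (hDM (mem_br (hB b hb) hx))
    · intro f hf g hg x hx
      obtain ⟨b, hb, rfl⟩ := Finset.mem_image.mp hf
      obtain ⟨c, hc, rfl⟩ := Finset.mem_image.mp hg
      have e : (adm (K := K) b * adm (K := K) c - adm (K := K) c * adm (K := K) b) x =
          (b * c - c * b) * x - x * (b * c - c * b) := by
        simp only [LinearMap.sub_apply, Module.End.mul_apply, adm_apply]
        noncomm_ring
      rw [e]
      exact mem_br (mem_br (hB b hb) (hB c hc)) hx
    · intro f hf
      obtain ⟨b, hb, rfl⟩ := Finset.mem_image.mp hf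
      rw [adm_pow b N (hN b hb)]
      exact zero_mem _
  obtain ⟨S, S0, S1⟩ : ∃ S : ℕ → Finset A, S 0 = Finset.image₂ (fun f x => f x) aB B ∧
      ∀ j, S (j + 1) = Finset.image₂ (fun f x => f x) aB (S j) :=
    ⟨fun j => Nat.rec (Finset.image₂ (fun f x => f x) aB B)
      (fun _ s => Finset.image₂ (fun f x => f x) aB s) j, rfl, fun _ => rfl⟩
  have Sc : ∀ j, (S j).card ≤ d ^ (j + 2) := by
    intro j
    induction j with
    | zero =>
      rw [S0]
      refine (Finset.card_image₂_le _ _ _).trans ?_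
      rw [zero_add, pow_two]
      exact Nat.mul_le_mul haBc hd
    | succ j ih =>
      rw [S1]
      refine (Finset.card_image₂_le _ _ _).trans ?_
      rw [pow_succ' d (j + 2)]
      exact Nat.mul_le_mul haBc ih
  let T : ℕ → Finset A := fun k => (Finset.range k).biUnion S
  have hspM : Submodule.span K (B : Set A) ≤ M := Submodule.span_le.mpr hB
  have adW : ∀ x ∈ Submodule.span K (B : Set A), adm (K := K) x ∈ W := by
    intro x hx
    induction hx using Submodule.span_induction with
    | mem x hx => exact Submodule.subset_span (by simpa [haB] using ⟨x, hx, rfl⟩)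
    | zero =>
      have : adm (K := K) (0 : A) = 0 := by ext; simp [adm_apply]
      rw [this]; exact zero_mem _
    | add x y _ _ h1 h2 =>
      have : adm (K := K) (x + y) = adm x + adm y := by
        ext z; simp only [adm_apply, LinearMap.add_apply]; noncomm_ring
      rw [this]; exact add_mem h1 h2
    | smul c x _ h =>
      have : adm (K := K) (c • x) = c • adm x := by
        ext z; simp only [adm_apply, LinearMap.smul_apply, smul_mul_assoc, mul_smul_comm, smul_sub]
      rw [this]; exact Submodule.smul_mem _ _ h
  -- basic decomposition
  have base : D ≤ Submodule.span K ((S 0 : Finset A) : Set A) ⊔ app W D ⊔ E := by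
    rw [hD, br_le]
    intro x hx y hy
    obtain ⟨b, hb, u, hu, rfl⟩ := Submodule.mem_sup.mp (hs hx)
    obtain ⟨c, hc, v, hv, rfl⟩ := Submodule.mem_sup.mp (hs hy)
    have e : (b + u) * (c + v) - (c + v) * (b + u) =
        ((b * c - c * b) + ((b * v - v * b) - (c * u - u * c))) + (u * v - v * u) := by
      noncomm_ring
    rw [e]
    refine Submodule.add_mem_sup (Submodule.add_mem_sup ?_ (sub_mem ?_ ?_)) (mem_br hu hv)
    · rw [S0, ← app_span_finset]
      exact mem_app (adW b hb) hc
    · exact mem_app (adW b hb) hv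
    · exact mem_app (adW c hc) hu
  have WE : app W E ≤ E := by
    rw [app_le]
    intro f hf
    induction hf using Submodule.span_induction with
    | mem f hf =>
      obtain ⟨b, hb, rfl⟩ := Finset.mem_image.mp hf
      exact fun y hy => hME b (hB b hb) y hy
    | zero => intro y _; rw [LinearMap.zero_apply]; exact zero_mem _
    | add f g _ _ h1 h2 =>
      intro y hy; rw [LinearMap.add_apply]; exact add_mem (h1 y hy) (h2 y hy)
    | smul c f _ h =>
      intro y hy; rw [LinearMap.smul_apply]; exact Submodule.smul_mem _ _ (h y hy)
  have spanT : ∀ k, Submodule.span K ((S k : Finset A) : Set A) ≤ Submodule.span K ((T (k + 1) : Finset A) : Set A) := by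
    intro k
    refine Submodule.span_mono ?_
    rw [Finset.coe_subset]
    exact Finset.subset_biUnion_of_mem S (Finset.mem_range.mpr (Nat.lt_succ_self k))
  have Tmono : ∀ k, Submodule.span K ((T k : Finset A) : Set A) ≤ Submodule.span K ((T (k + 1) : Finset A) : Set A) := by
    intro k
    refine Submodule.span_mono ?_
    rw [Finset.coe_subset]
    exact Finset.biUnion_subset_biUnion_of_subset_left _ (Finset.range_mono (Nat.le_succ k))
  have WT : ∀ k, app W (Submodule.span K ((T k : Finset A) : Set A)) ≤ Submodule.span K ((T (k + 1) : Finset A) : Set A) := by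
    intro k
    rw [hW, app_span_finset]
    refine Submodule.span_mono ?_
    rw [Finset.coe_subset]
    intro z hz
    obtain ⟨f, hf, x, hx, rfl⟩ := Finset.mem_image₂.mp hz
    obtain ⟨j, hj, hx⟩ := Finset.mem_biUnion.mp hx
    refine Finset.mem_biUnion.mpr ⟨j + 1, ?_, ?_⟩
    · rw [Finset.mem_range] at hj ⊢; omega
    · rw [S1]; exact Finset.mem_image₂_of_mem hf hx
  have T0le : ∀ k, Submodule.span K ((S 0 : Finset A) : Set A) ≤ Submodule.span K ((T (k + 1) : Finset A) : Set A) := by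
    intro k
    induction k with
    | zero => exact spanT 0
    | succ k ih => exact ih.trans (Tmono _)
  have iter : ∀ k, D ≤ Submodule.span K ((T k : Finset A) : Set A) ⊔ app (W ^ k) D ⊔ E := by
    intro k
    induction k with
    | zero =>
      intro x hx
      refine Submodule.mem_sup_left (Submodule.mem_sup_right ?_)
      rw [pow_zero]
      have := mem_app (X := (1 : Submodule K (Module.End K A))) (f := 1) (Submodule.one_le.mp le_rfl) hx
      simpa using this
    | succ k ih =>
      refine base.trans (sup_le (sup_le ?_ ?_) le_sup_right)
      · exact (T0le k).trans (le_sup_left.trans le_sup_left)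
      · refine (app_mono ih).trans ?_
        rw [app_sup, app_sup]
        refine sup_le_sup (sup_le_sup (WT k) ?_) WE
        rw [pow_succ']
        exact app_app_le _ _ _
  have WE' : app (W ^ (aB.card * (2 * N) + 1)) D ≤ E := by
    rw [app_le]
    exact fun f hf y hy => hWJ hf y hy
  refine ⟨T (aB.card * (2 * N) + 1), ?_, ?_⟩
  · refine Finset.card_biUnion_le.trans ?_
    unfold gb
    calc ∑ j ∈ Finset.range (aB.card * (2 * N) + 1), (S j).card
        ≤ ∑ j ∈ Finset.range (aB.card * (2 * N) + 1), d ^ (j + 2) :=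
          Finset.sum_le_sum fun j _ => Sc j
      _ ≤ _ := Finset.sum_le_sum_of_subset (Finset.range_mono (by gcongr))
  · refine (iter _).trans (sup_le (sup_le le_sup_left (WE'.trans le_sup_right)) le_sup_right)

lemma choose_gens (M D : Submodule K A) (S : Set A) (hS : S ⊆ M) (hMS : M ≤ Submodule.span K S)
    (hDM : D ≤ M) (T : Finset A) (hT : M ≤ Submodule.span K (T : Set A) ⊔ D) :
    ∃ B : Finset A, (∀ b ∈ B, b ∈ S) ∧ B.card ≤ T.card ∧
      M ≤ Submodule.span K (B : Set A) ⊔ D := by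
  classical
  have hSM : Submodule.span K S = M := le_antisymm (Submodule.span_le.mpr hS) hMS
  set π := D.mkQ with hπ
  obtain ⟨b, hbS, hbspan, hbli⟩ := exists_linearIndependent K (Set.image π S)
  have h1 : Submodule.span K b ≤ Submodule.span K ((T.image π : Finset (A ⧸ D)) : Set (A ⧸ D)) := by
    rw [hbspan, ← Submodule.map_span, hSM]
    refine (Submodule.map_mono hT).trans ?_
    rw [Submodule.map_sup, Submodule.map_span, Finset.coe_image]
    refine sup_le le_rfl ?_
    rw [hπ, Submodule.mkQ_map_self]; exact bot_le
  have hbT : b ⊆ Submodule.span K ((T.image π : Finset (A ⧸ D)) : Set (A ⧸ D)) :=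
    Submodule.subset_span.trans h1
  have hbfin : b.Finite := by
    have := LinearIndependent.finite_of_le_span_finite (R := K) (fun x : b => (x : A ⧸ D)) hbli
      ((T.image π : Finset (A ⧸ D)) : Set (A ⧸ D)) (by simpa using hbT)
    exact Set.toFinite b
  have hbcard : hbfin.toFinset.card ≤ T.card := by
    have := hbfin.fintype
    have := linearIndependent_le_span' (R := K) (fun x : b => (x : A ⧸ D)) hbli
      ((T.image π : Finset (A ⧸ D)) : Set (A ⧸ D)) (by simpa using hbT)
    rw [Cardinal.mk_fintype] at this
    have h3 : Fintype.card b ≤ (T.image π).card := by simpa using this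
    rw [Set.Finite.card_toFinset]
    exact h3.trans Finset.card_image_le
  have hbS' : ∀ y : A ⧸ D, ∃ x : A, y ∈ b → x ∈ S ∧ π x = y := by
    intro y
    by_cases hy : y ∈ b
    · obtain ⟨x, hx, hxy⟩ := hbS hy
      exact ⟨x, fun _ => ⟨hx, hxy⟩⟩
    · exact ⟨0, fun h => absurd h hy⟩
  choose g hg using hbS'
  refine ⟨hbfin.toFinset.image g, ?_, Finset.card_image_le.trans hbcard, ?_⟩
  · intro x hx
    obtain ⟨y, hy, rfl⟩ := Finset.mem_image.mp hx
    exact (hg y (hbfin.mem_toFinset.mp hy)).1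
  · have : Submodule.map π M ≤ Submodule.map π
        (Submodule.span K ((hbfin.toFinset.image g : Finset A) : Set A)) := by
      rw [← hSM, Submodule.map_span, ← hbspan, Submodule.map_span]
      refine Submodule.span_mono ?_
      intro y hy
      exact ⟨g y, by simpa using ⟨y, hy, rfl⟩, (hg y hy).2⟩
    have h5 := Submodule.comap_mono (f := π) this
    rw [Submodule.comap_map_eq, Submodule.comap_map_eq, hπ, Submodule.ker_mkQ] at h5
    exact le_sup_left.trans h5

/-- The nilpotency bound. -/
def cb (N : ℕ) : ℕ → ℕ → ℕ
  | 0, _ => 1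
  | s + 1, d => (d * N + 1) * cb N s (gb N d)

theorem nil_bound (N : ℕ) (Q : Submodule K A → Prop) (hQ1 : ∀ M, Q M → Q (br M M))
    (hQ2 : ∀ M, Q M → br M M ≤ M) (hQ3 : ∀ M, Q M → M ≤ Submodule.span K {x | x ∈ M ∧ x ^ N = 0}) :
    ∀ (s d : ℕ) (M : Submodule K A), Q M → (fun M => br M M)^[s] M = ⊥ →
      (∃ T : Finset A, T.card ≤ d ∧ M ≤ Submodule.span K (T : Set A) ⊔ br M M) →
      M ^ (cb N s d) = ⊥ := by
  intro s
  induction s with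
  | zero => intro d M _ h0 _; rw [cb, pow_one]; exact h0
  | succ s ih =>
    rintro d M hM h0 ⟨T, hTd, hT⟩
    obtain ⟨B, hB, hBT, hMB⟩ := choose_gens M (br M M) {x | x ∈ M ∧ x ^ N = 0} (fun x hx => hx.1)
      (hQ3 M hM) (hQ2 M hM) T hT
    have hg := gen_step M (hQ2 M hM) B (fun b hb => (hB b hb).1) N d (fun b hb => (hB b hb).2) hMB
      (hBT.trans hTd)
    have hD := ih (gb N d) (br M M) (hQ1 M hM) h0 hg
    have := pow_step M (hQ2 M hM) B (fun b hb => (hB b hb).1) N _ (fun b hb => (hB b hb).2) hMB hD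
    rw [cb]
    have hle : (B.card * N + 1) * cb N s (gb N d) ≤ (d * N + 1) * cb N s (gb N d) := by
      have := hBT.trans hTd
      gcongr
    obtain ⟨t, ht⟩ := Nat.exists_eq_add_of_le hle
    rw [ht, pow_add, this, Submodule.bot_mul]

end Assoc2

end FrobExp

namespace FrobExp

section Gr

open Polynomial

variable {K : Type*} [Field K] {B : Type*} [Ring B] [Algebra K B]

/-- A decreasing multiplicative filtration. -/
structure Filt (K B : Type*) [Field K] [Ring B] [Algebra K B] where
  fil : ℕ → Submodule K B
  anti : ∀ i, fil (i + 1) ≤ fil i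
  zero_eq : fil 0 = ⊤
  mul_mem : ∀ i j x y, x ∈ fil i → y ∈ fil j → x * y ∈ fil (i + j)

variable (Φ : Filt K B)

/-- The Rees algebra of a filtration. -/
def rees : Subalgebra K B[X] where
  carrier := {f | ∀ i, f.coeff i ∈ Φ.fil i}
  mul_mem' := by
    intro f g hf hg i
    rw [coeff_mul]
    refine sum_mem fun x hx => ?_
    rw [← Finset.HasAntidiagonal.mem_antidiagonal.mp hx]
    exact Φ.mul_mem _ _ _ _ (hf _) (hg _)
  add_mem' := by
    intro f g hf hg i
    rw [coeff_add]
    exact add_mem (hf i) (hg i)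
  algebraMap_mem' := by
    intro r i
    rw [Polynomial.algebraMap_apply, coeff_C]
    split_ifs with h
    · rw [h, Φ.zero_eq]; trivial
    · exact zero_mem _

lemma mem_rees {f : B[X]} : f ∈ rees Φ ↔ ∀ i, f.coeff i ∈ Φ.fil i := Iff.rfl

/-- The ideal of the Rees algebra defining the associated graded algebra. -/
def reesIdeal : Ideal (rees Φ) where
  carrier := {f | ∀ i, f.1.coeff i ∈ Φ.fil (i + 1)}
  add_mem' := by
    intro f g hf hg i
    simpa using add_mem (hf i) (hg i)
  zero_mem' := by intro i; simp
  smul_mem' := by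
    intro f g hg i
    simp only [smul_eq_mul, Subalgebra.coe_mul, coeff_mul]
    refine sum_mem fun x hx => ?_
    have := Φ.mul_mem _ _ _ _ (f.2 x.1) (hg x.2)
    rwa [← add_assoc, Finset.HasAntidiagonal.mem_antidiagonal.mp hx] at this

lemma mem_reesIdeal {f : rees Φ} : f ∈ reesIdeal Φ ↔ ∀ i, f.1.coeff i ∈ Φ.fil (i + 1) := Iff.rfl

instance : (reesIdeal Φ).IsTwoSided := ⟨by
  intro f g hf i
  simp only [Subalgebra.coe_mul, coeff_mul]
  refine sum_mem fun x hx => ?_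
  have := Φ.mul_mem _ _ _ _ (hf x.1) (g.2 x.2)
  rwa [add_right_comm, Finset.HasAntidiagonal.mem_antidiagonal.mp hx] at this⟩

/-- The associated graded algebra. -/
abbrev Gr := rees Φ ⧸ reesIdeal Φ

lemma monomial_mem_rees {i : ℕ} {x : B} (hx : x ∈ Φ.fil i) : monomial i x ∈ rees Φ := by
  intro j
  rw [coeff_monomial]
  split_ifs with h
  · rwa [← h]
  · exact zero_mem _

open Classical in
/-- The symbol map. -/
noncomputable def symb (i : ℕ) (x : B) : Gr Φ :=
  if h : x ∈ Φ.fil i then Ideal.Quotient.mk _ ⟨monomial i x, monomial_mem_rees Φ h⟩ else 0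

variable {Φ}

lemma symb_of_mem {i : ℕ} {x : B} (h : x ∈ Φ.fil i) :
    symb Φ i x = Ideal.Quotient.mk _ ⟨monomial i x, monomial_mem_rees Φ h⟩ := by
  unfold symb; rw [dif_pos h]

lemma symb_add {i : ℕ} {x y : B} (hx : x ∈ Φ.fil i) (hy : y ∈ Φ.fil i) :
    symb Φ i (x + y) = symb Φ i x + symb Φ i y := by
  rw [symb_of_mem hx, symb_of_mem hy, symb_of_mem (add_mem hx hy), ← map_add]
  congr 1
  ext1
  simp

lemma symb_smul {i : ℕ} (c : K) {x : B} (hx : x ∈ Φ.fil i) :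
    symb Φ i (c • x) = c • symb Φ i x := by
  rw [symb_of_mem hx, symb_of_mem (Submodule.smul_mem _ c hx)]
  change _ = Ideal.Quotient.mk _ (c • _)
  congr 1
  ext1
  exact (smul_monomial c i x).symm

lemma symb_mul {i j : ℕ} {x y : B} (hx : x ∈ Φ.fil i) (hy : y ∈ Φ.fil j) :
    symb Φ i x * symb Φ j y = symb Φ (i + j) (x * y) := by
  rw [symb_of_mem hx, symb_of_mem hy, symb_of_mem (Φ.mul_mem _ _ _ _ hx hy), ← map_mul]
  congr 1
  ext1
  simp [monomial_mul_monomial]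

lemma symb_eq_zero {i : ℕ} {x : B} (hx : x ∈ Φ.fil i) :
    symb Φ i x = 0 ↔ x ∈ Φ.fil (i + 1) := by
  rw [symb_of_mem hx, Ideal.Quotient.eq_zero_iff_mem, mem_reesIdeal]
  constructor
  · intro h
    simpa using h i
  · intro h j
    simp only [coeff_monomial]
    split_ifs with e
    · rwa [← e]
    · exact zero_mem _

lemma symb_one : symb Φ 0 1 = 1 := by
  rw [symb_of_mem (by rw [Φ.zero_eq]; trivial), ← map_one (Ideal.Quotient.mk (reesIdeal Φ))]
  congr 1

lemma symb_map (θ : B →ₐ[K] B) (hθ : ∀ i x, x ∈ Φ.fil i → θ x ∈ Φ.fil i) :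
    ∃ Θ : Gr Φ →ₐ[K] Gr Φ, ∀ i x, x ∈ Φ.fil i → Θ (symb Φ i x) = symb Φ i (θ x) := by
  have h1 : ∀ f : rees Φ, Polynomial.mapAlgHom θ f.1 ∈ rees Φ := by
    intro f i
    rw [Polynomial.coe_mapAlgHom, coeff_map]
    exact hθ i _ (f.2 i)
  let ψ : rees Φ →ₐ[K] rees Φ :=
    ((Polynomial.mapAlgHom θ).comp (rees Φ).val).codRestrict (rees Φ) h1
  have hψ : ∀ f, f ∈ reesIdeal Φ → (Ideal.Quotient.mkₐ K (reesIdeal Φ)).comp ψ f = 0 := by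
    intro f hf
    rw [AlgHom.comp_apply, Ideal.Quotient.mkₐ_eq_mk, Ideal.Quotient.eq_zero_iff_mem]
    intro i
    change ((Polynomial.mapAlgHom θ) f.1).coeff i ∈ _
    rw [Polynomial.coe_mapAlgHom, coeff_map]
    exact hθ _ _ (hf i)
  refine ⟨Ideal.Quotient.liftₐ _ _ hψ, fun i x hx => ?_⟩
  rw [symb_of_mem hx, symb_of_mem (hθ i x hx)]
  change Ideal.Quotient.mk _ (ψ _) = _
  congr 1
  ext1
  change (Polynomial.mapAlgHom θ) (monomial i x) = _
  simp

end Gr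

end FrobExp

namespace FrobExp

open scoped commutatorElement

section Aug

variable (K : Type*) [Field K] {G : Type*} [Group G]

/-- group elements in the group algebra -/
noncomputable def ug (g : G) : MonoidAlgebra K G := MonoidAlgebra.of K G g

lemma ug_mul (g h : G) : ug K (g * h) = ug K g * ug K h := map_mul _ _ _
lemma ug_one : ug K (1 : G) = 1 := map_one _
lemma ug_pow (g : G) (k : ℕ) : ug K (g ^ k) = ug K g ^ k := map_pow _ _ _
lemma ug_inj {g h : G} (e : ug K g = ug K h) : g = h := MonoidAlgebra.of_injective e
lemma ug_inv_mul (g : G) : ug K g⁻¹ * ug K g = 1 := by rw [← ug_mul, inv_mul_cancel, ug_one]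
lemma ug_mul_inv (g : G) : ug K g * ug K g⁻¹ = 1 := by rw [← ug_mul, mul_inv_cancel, ug_one]

lemma ug_span : (⊤ : Submodule K (MonoidAlgebra K G)) = Submodule.span K (Set.range (ug K)) := by
  symm
  rw [eq_top_iff]
  intro x _
  induction x using MonoidAlgebra.induction_on with
  | of g => exact Submodule.subset_span ⟨g, rfl⟩
  | add f g h1 h2 => exact add_mem (h1 trivial) (h2 trivial)
  | smul r f h => exact Submodule.smul_mem _ _ (h trivial)

/-- The span of the elements `g - 1` for `g` in a set. -/
noncomputable def augS (N : Set G) : Submodule K (MonoidAlgebra K G) :=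
  Submodule.span K (Set.image (fun g => ug K g - 1) N)

lemma mem_augS {N : Set G} {g : G} (hg : g ∈ N) : ug K g - 1 ∈ augS K N :=
  Submodule.subset_span ⟨g, hg, rfl⟩

lemma top_mul_augS (N : Subgroup G) [hN : N.Normal] :
    (⊤ : Submodule K (MonoidAlgebra K G)) * augS K (N : Set G) ≤ augS K (N : Set G) * ⊤ := by
  conv_lhs => rw [ug_span]
  unfold augS
  rw [Submodule.span_mul_span, Submodule.span_le]
  rintro _ ⟨_, ⟨h, rfl⟩, _, ⟨g, hg, rfl⟩, rfl⟩
  have : ug K h * (ug K g - 1) = (ug K (h * g * h⁻¹) - 1) * ug K h := by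
    rw [ug_mul, ug_mul, sub_mul, mul_assoc, ug_inv_mul, mul_sub, mul_one, mul_one, one_mul]
  simp only [SetLike.mem_coe]
  rw [this]
  exact Submodule.mul_mem_mul (mem_augS K (hN.conj_mem g hg h)) trivial

lemma sub_one_pow (p : ℕ) [Fact p.Prime] [CharP K p] (g : G) (k : ℕ) :
    (ug K g - 1) ^ (p ^ k) = ug K (g ^ (p ^ k)) - 1 := by
  have : CharP (MonoidAlgebra K G) p :=
    charP_of_injective_algebraMap (algebraMap K (MonoidAlgebra K G)).injective p
  rw [sub_pow_char_pow_of_commute p k (Commute.one_right _), one_pow, ug_pow]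

lemma augS_nil (p : ℕ) [Fact p.Prime] [CharP K p] [Finite G] (hG : IsPGroup p G) (s : ℕ) :
    ∀ i, derivedSeries G (i + s) = ⊥ →
    ∃ k, (augS K (derivedSeries G i : Set G) * ⊤) ^ k = ⊥ := by
  classical
  induction s with
  | zero =>
    intro i hi
    refine ⟨1, ?_⟩
    rw [add_zero] at hi
    rw [pow_one, hi]
    have : augS K ((⊥ : Subgroup G) : Set G) = ⊥ := by
      unfold augS
      simp [ug_one]
    rw [this, Submodule.bot_mul]
  | succ s ih =>
    intro i hi
    obtain ⟨k, hk⟩ := ih (i + 1) (by rw [← hi]; congr 1; omega)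
    set N := derivedSeries G i with hN
    set N' := derivedSeries G (i + 1) with hN'
    have hNn : N.Normal := inferInstance
    have hNn' : N'.Normal := inferInstance
    set J := augS K (N' : Set G) * ⊤ with hJ
    have Jr : J * ⊤ ≤ J := by rw [hJ, mul_assoc]; exact mul_le_mul_right le_top _
    have Jl : ⊤ * J ≤ J := by
      rw [hJ, ← mul_assoc]
      refine (mul_le_mul_left (top_mul_augS K N') _).trans ?_
      rw [mul_assoc]; exact mul_le_mul_right le_top _
    obtain ⟨m, hm⟩ := IsPGroup.iff_card.mp hG
    set B : Finset (MonoidAlgebra K G) :=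
      ((N : Set G).toFinite.toFinset).image (fun g => ug K g - 1) with hB
    have hBspan : Submodule.span K (B : Set (MonoidAlgebra K G)) = augS K (N : Set G) := by
      rw [hB]; unfold augS; simp
    have memB : ∀ b ∈ B, ∃ g ∈ N, ug K g - 1 = b := by
      intro b hb
      obtain ⟨g, hg, rfl⟩ := Finset.mem_image.mp hb
      exact ⟨g, by simpa using hg, rfl⟩
    have key := comm_nil (p ^ m) J B
      (fun b _ x hx => Jl (Submodule.mul_mem_mul trivial hx))
      (fun b _ x hx => Jr (Submodule.mul_mem_mul hx trivial)) (by
        intro b hb c hc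
        obtain ⟨g, hg, rfl⟩ := memB b hb
        obtain ⟨h, hh, rfl⟩ := memB c hc
        have e : (ug K g - 1) * (ug K h - 1) - (ug K h - 1) * (ug K g - 1) =
            (ug K ⁅g, h⁆ - 1) * (ug K (h * g)) := by
          rw [sub_mul (ug K ⁅g, h⁆), ← ug_mul, commutatorElement_def]
          have : g * h * g⁻¹ * h⁻¹ * (h * g) = g * h := by group
          rw [this, ug_mul, ug_mul]
          noncomm_ring
        rw [e]
        refine Submodule.mul_mem_mul (mem_augS K ?_) trivial
        rw [hN', derivedSeries_succ]
        exact Subgroup.commutator_mem_commutator hg hh) (by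
        intro b hb
        obtain ⟨g, hg, rfl⟩ := memB b hb
        rw [sub_one_pow, ← hm, pow_card_eq_one', ug_one, sub_self]
        exact zero_mem _)
    rw [hBspan] at key
    have hr : ∀ r : ℕ, (augS K (N : Set G) * ⊤) ^ (r + 1) ≤ augS K (N : Set G) ^ (r + 1) * ⊤ := by
      intro r
      induction r with
      | zero => rw [zero_add, pow_one, pow_one]
      | succ r ihr =>
        calc (augS K (N : Set G) * ⊤) ^ (r + 1 + 1)
            = (augS K (N : Set G) * ⊤) ^ (r + 1) * (augS K (N : Set G) * ⊤) := pow_succ _ _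
          _ ≤ augS K (N : Set G) ^ (r + 1) * ⊤ * (augS K (N : Set G) * ⊤) := mul_le_mul_left ihr _
          _ = augS K (N : Set G) ^ (r + 1) * (⊤ * augS K (N : Set G)) * ⊤ := by
            simp only [mul_assoc]
          _ ≤ augS K (N : Set G) ^ (r + 1) * (augS K (N : Set G) * ⊤) * ⊤ :=
            mul_le_mul_left (mul_le_mul_right (top_mul_augS K N) _) _
          _ = augS K (N : Set G) ^ (r + 1 + 1) * (⊤ * ⊤) := by
            rw [pow_succ _ (r + 1)]; simp only [mul_assoc]
          _ ≤ _ := mul_le_mul_right le_top _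
    refine ⟨(B.card * p ^ m + 1) * k, ?_⟩
    rw [pow_mul, ← le_bot_iff, ← hk]
    refine pow_le_pow_left' ?_ k
    refine (hr _).trans ((mul_le_mul_left key _).trans Jr)

variable (G) in
/-- The augmentation ideal. -/
noncomputable def aug : Submodule K (MonoidAlgebra K G) := augS K Set.univ

lemma mem_aug (g : G) : ug K g - 1 ∈ aug K G := mem_augS K trivial

lemma aug_mul_top : aug K G * ⊤ ≤ aug K G := by
  rw [ug_span]
  unfold aug augS
  rw [Submodule.span_mul_span, Submodule.span_le]
  rintro _ ⟨_, ⟨g, _, rfl⟩, _, ⟨h, rfl⟩, rfl⟩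
  have : (ug K g - 1) * ug K h = (ug K (g * h) - 1) - (ug K h - 1) := by
    rw [ug_mul]; noncomm_ring
  simp only [SetLike.mem_coe]
  rw [this]
  exact sub_mem (mem_aug K _) (mem_aug K _)

lemma top_mul_aug : ⊤ * aug K G ≤ aug K G := by
  have := top_mul_augS K (⊤ : Subgroup G)
  rw [Subgroup.coe_top] at this
  exact this.trans (aug_mul_top K)

lemma aug_nil (p : ℕ) [Fact p.Prime] [CharP K p] [Finite G] (hG : IsPGroup p G) :
    ∃ k, aug K G ^ k = ⊥ := by
  have : Group.IsNilpotent G := hG.isNilpotent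
  obtain ⟨s, hs⟩ := (inferInstance : Group.IsSolvable G).solvable
  obtain ⟨k, hk⟩ := augS_nil K p hG s 0 (by rwa [zero_add])
  refine ⟨k, ?_⟩
  rw [← le_bot_iff, ← hk]
  refine pow_le_pow_left' ?_ k
  intro x hx
  have h2 : x ∈ augS K (derivedSeries G 0 : Set G) := by
    rw [derivedSeries_zero, Subgroup.coe_top]; exact hx
  simpa using Submodule.mul_mem_mul h2 (Submodule.mem_top (x := (1 : MonoidAlgebra K G)))

variable (G) in
/-- The augmentation filtration. -/
noncomputable def augFilt : Filt K (MonoidAlgebra K G) where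
  fil i := if i = 0 then ⊤ else aug K G ^ i
  anti i := by
    by_cases hi : i = 0
    · simp [hi]
    · rw [if_neg hi, if_neg (Nat.succ_ne_zero i), pow_succ]
      obtain ⟨j, rfl⟩ := Nat.exists_eq_succ_of_ne_zero hi
      rw [Nat.succ_eq_add_one, pow_succ, mul_assoc]
      exact mul_le_mul_right ((mul_le_mul_right le_top _).trans (aug_mul_top K)) _
  zero_eq := by simp
  mul_mem i j x y hx hy := by
    by_cases hi : i = 0
    · subst hi
      by_cases hj : j = 0
      · simp [hj]
      · rw [zero_add]
        rw [if_neg hj] at hy ⊢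
        obtain ⟨j, rfl⟩ := Nat.exists_eq_succ_of_ne_zero hj
        rw [Nat.succ_eq_add_one, pow_succ'] at hy ⊢
        have h1 : x * y ∈ ⊤ * (aug K G * aug K G ^ j) :=
          Submodule.mul_mem_mul (Submodule.mem_top (x := x)) hy
        rw [← mul_assoc] at h1
        exact mul_le_mul_left (top_mul_aug K) _ h1
    · by_cases hj : j = 0
      · subst hj
        rw [add_zero]
        rw [if_neg hi] at hx ⊢
        obtain ⟨i, rfl⟩ := Nat.exists_eq_succ_of_ne_zero hi
        rw [Nat.succ_eq_add_one, pow_succ] at hx ⊢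
        have h1 : x * y ∈ (aug K G ^ i * aug K G) * ⊤ :=
          Submodule.mul_mem_mul hx (Submodule.mem_top (x := y))
        rw [mul_assoc] at h1
        exact mul_le_mul_right (aug_mul_top K) _ h1
      · rw [if_neg hi] at hx
        rw [if_neg hj] at hy
        rw [if_neg (by omega), pow_add]
        exact Submodule.mul_mem_mul hx hy

lemma augFilt_of_pos {i : ℕ} (hi : 0 < i) : (augFilt K G).fil i = aug K G ^ i := by
  simp [augFilt, hi.ne']

lemma augFilt_one (x : MonoidAlgebra K G) (hx : x ∈ aug K G) : x ∈ (augFilt K G).fil 1 := by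
  rw [augFilt_of_pos K one_pos, pow_one]; exact hx

lemma augFilt_zero (x : MonoidAlgebra K G) : x ∈ (augFilt K G).fil 0 := by
  rw [(augFilt K G).zero_eq]; trivial

lemma aug_pow_le (i : ℕ) : aug K G ^ i ≤ (augFilt K G).fil i := by
  rcases Nat.eq_zero_or_pos i with h | h
  · rw [h, (augFilt K G).zero_eq]; exact le_top
  · rw [augFilt_of_pos K h]

lemma augFilt_le {i j : ℕ} (h : i ≤ j) : (augFilt K G).fil j ≤ (augFilt K G).fil i :=
  antitone_nat_of_succ_le (augFilt K G).anti h

end Aug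

/-- Data of the Jennings-type graded algebra of a group. -/
structure GrData (K A G : Type*) [Field K] [Ring A] [Algebra K A] [Group G] (p : ℕ) where
  D : ℕ → Subgroup G
  τ : ℕ → G → A
  D_one : D 1 = ⊤
  τ_mul : ∀ m g h, 1 ≤ m → g ∈ D m → h ∈ D m → τ m (g * h) = τ m g + τ m h
  comm_mem : ∀ i j g h, g ∈ D i → h ∈ D j → ⁅g, h⁆ ∈ D (i + j)
  τ_comm : ∀ i j g h, g ∈ D i → h ∈ D j → τ i g * τ j h - τ j h * τ i g = τ (i + j) ⁅g, h⁆
  τ_pow : ∀ m k g, g ∈ D m → g ^ (p ^ k) = 1 → τ m g ^ (p ^ k) = 0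
  act_mem : ∀ (α : MulAut G) m g, g ∈ D m → α g ∈ D m
  act : ∀ (α : MulAut G), ∃ Θ : A →ₐ[K] A, ∀ m g, g ∈ D m → Θ (τ m g) = τ m (α g)
  nilp : ∀ c q, (Submodule.span K (Set.range (τ 1))) ^ c = ⊥ → c ≤ p ^ q → ∀ g : G, g ^ (p ^ q) = 1

section GrD

variable (K : Type*) [Field K] (G : Type*) [Group G]

/-- dimension subgroups -/
noncomputable def dimSub (m : ℕ) : Subgroup G where
  carrier := {g | ug K g - 1 ∈ (augFilt K G).fil m}
  mul_mem' := by
    intro g h hg hh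
    have e : ug K (g * h) - 1 = (ug K g - 1) * ug K h + (ug K h - 1) := by
      rw [ug_mul]; noncomm_ring
    rw [Set.mem_ofPred_eq, e]
    exact add_mem ((augFilt K G).mul_mem m 0 _ _ hg (augFilt_zero K _)) hh
  one_mem' := by
    rw [Set.mem_ofPred_eq, ug_one, sub_self]; exact zero_mem _
  inv_mem' := by
    intro g hg
    have e : ug K g⁻¹ - 1 = - ((ug K g - 1) * ug K g⁻¹) := by
      rw [sub_mul, ug_mul_inv]; noncomm_ring
    rw [Set.mem_ofPred_eq, e]
    exact neg_mem ((augFilt K G).mul_mem m 0 _ _ hg (augFilt_zero K _))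

variable {G}

lemma mem_dimSub {m : ℕ} {g : G} : g ∈ dimSub K G m ↔ ug K g - 1 ∈ (augFilt K G).fil m := Iff.rfl

lemma symb_pow {B : Type*} [Ring B] [Algebra K B] {Φ : Filt K B} {m : ℕ} {x : B}
    (hx : x ∈ Φ.fil m) (k : ℕ) : x ^ k ∈ Φ.fil (k * m) ∧ symb Φ m x ^ k = symb Φ (k * m) (x ^ k) := by
  induction k with
  | zero =>
    refine ⟨?_, ?_⟩
    · rw [zero_mul, Φ.zero_eq]; trivial
    · rw [zero_mul, pow_zero, pow_zero, symb_one]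
  | succ k ih =>
    have := Φ.mul_mem _ _ _ _ ih.1 hx
    rw [add_mul, one_mul, pow_succ, pow_succ, ih.2, symb_mul ih.1 hx]
    exact ⟨this, rfl⟩

lemma comm_fil {i j : ℕ} {g h : G} (hg : g ∈ dimSub K G i) (hh : h ∈ dimSub K G j) :
    ⁅g, h⁆ ∈ dimSub K G (i + j) ∧
      symb (augFilt K G) i (ug K g - 1) * symb (augFilt K G) j (ug K h - 1)
      - symb (augFilt K G) j (ug K h - 1) * symb (augFilt K G) i (ug K g - 1)
      = symb (augFilt K G) (i + j) (ug K ⁅g, h⁆ - 1) := by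
  set Φ := augFilt K G
  set x := (ug K g - 1) * (ug K h - 1) with hx
  set y := (ug K h - 1) * (ug K g - 1) with hy
  have hxm : x ∈ Φ.fil (i + j) := Φ.mul_mem _ _ _ _ hg hh
  have hym : y ∈ Φ.fil (i + j) := by rw [add_comm]; exact Φ.mul_mem _ _ _ _ hh hg
  have hnym : (-1 : K) • y ∈ Φ.fil (i + j) := Submodule.smul_mem _ _ hym
  have hz : x + (-1 : K) • y ∈ Φ.fil (i + j) := add_mem hxm hnym
  have hw : (x + (-1 : K) • y) * (ug K (h * g)⁻¹ - 1) ∈ Φ.fil (i + j + 1) :=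
    Φ.mul_mem _ _ _ _ hz (augFilt_one K _ (mem_aug K _))
  have hw' := Φ.anti _ hw
  have e : ug K ⁅g, h⁆ - 1 = (x + (-1 : K) • y) + (x + (-1 : K) • y) * (ug K (h * g)⁻¹ - 1) := by
    have e1 : x + (-1 : K) • y = ug K (g * h) - ug K (h * g) := by
      rw [hx, hy, ug_mul, ug_mul, neg_one_smul]; noncomm_ring
    have e2 : ug K ⁅g, h⁆ = ug K (g * h) * ug K (h * g)⁻¹ := by
      rw [← ug_mul, commutatorElement_def]; congr 1; group
    rw [e1, e2, mul_sub, mul_one, sub_mul, ug_mul_inv]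
    abel
  refine ⟨?_, ?_⟩
  · rw [mem_dimSub, e]
    exact add_mem hz hw'
  · rw [e, symb_add hz hw', (symb_eq_zero hw').mpr hw, add_zero, symb_add hxm hnym,
      symb_smul _ hym, symb_mul hg hh, symb_mul hh hg, neg_one_smul, ← sub_eq_add_neg, add_comm j i]

lemma aug_map (α : MulAut G) : ∃ θ : MonoidAlgebra K G →ₐ[K] MonoidAlgebra K G,
    (∀ g, θ (ug K g - 1) = ug K (α g) - 1) ∧
    ∀ i x, x ∈ (augFilt K G).fil i → θ x ∈ (augFilt K G).fil i := by
  let θ : MonoidAlgebra K G →ₐ[K] MonoidAlgebra K G := (MonoidAlgebra.domCongr K K α).toAlgHom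
  have h0 : ∀ g, θ (ug K g) = ug K (α g) := fun g => MonoidAlgebra.domCongr_single α g 1
  have h1 : ∀ g, θ (ug K g - 1) = ug K (α g) - 1 := fun g => by rw [map_sub, map_one, h0]
  refine ⟨θ, h1, ?_⟩
  intro i x hx
  rcases Nat.eq_zero_or_pos i with h | h
  · rw [h]; exact augFilt_zero K _
  · rw [augFilt_of_pos K h] at hx ⊢
    have h2 : (aug K G).map θ.toLinearMap ≤ aug K G := by
      unfold aug augS
      rw [Submodule.map_span, Submodule.span_le]
      rintro _ ⟨_, ⟨g, _, rfl⟩, rfl⟩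
      change θ (ug K g - 1) ∈ _
      rw [h1]
      exact mem_aug K _
    have h3 : (aug K G ^ i).map θ.toLinearMap ≤ aug K G ^ i := by
      rw [Submodule.map_pow]
      exact pow_le_pow_left' h2 i
    exact h3 ⟨x, hx, rfl⟩

/-- The graded data of a finite `p`-group. -/
noncomputable def grData (p : ℕ) [Fact p.Prime] [CharP K p] [Finite G] (hG : IsPGroup p G) :
    GrData K (Gr (augFilt K G)) G p where
  D := dimSub K G
  τ m g := symb (augFilt K G) m (ug K g - 1)
  D_one := by
    rw [eq_top_iff]
    intro g _
    exact augFilt_one K _ (mem_aug K g)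
  τ_mul := by
    intro m g h hm hg hh
    have e : ug K (g * h) - 1 = (ug K g - 1) * (ug K h - 1) + ((ug K g - 1) + (ug K h - 1)) := by
      rw [ug_mul]; noncomm_ring
    have h1 := (augFilt K G).mul_mem _ _ _ _ hg hh
    have h2 := augFilt_le K (show m + 1 ≤ m + m by omega) h1
    have h3 := (augFilt K G).anti _ h2
    rw [e, symb_add h3 (add_mem hg hh), (symb_eq_zero h3).mpr h2, zero_add, symb_add hg hh]
  comm_mem i j g h hg hh := (comm_fil K hg hh).1
  τ_comm i j g h hg hh := (comm_fil K hg hh).2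
  τ_pow := by
    intro m k g hg hk
    rw [(symb_pow K hg _).2, sub_one_pow, hk, ug_one, sub_self]
    rw [symb_eq_zero (zero_mem _)]
    exact zero_mem _
  act_mem := by
    intro α m g hg
    obtain ⟨θ, h1, h2⟩ := aug_map K α
    rw [mem_dimSub, ← h1]
    exact h2 m _ hg
  act := by
    intro α
    obtain ⟨θ, h1, h2⟩ := aug_map K α
    obtain ⟨Θ, hΘ⟩ := symb_map θ h2
    refine ⟨Θ, fun m g hg => ?_⟩
    rw [hΘ m _ hg, h1]
  nilp := by
    intro c q hc hq g
    set Φ := augFilt K G with hΦ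
    set S := Submodule.span K (Set.range fun g => symb Φ 1 (ug K g - 1)) with hS
    have h1 : ∀ x ∈ aug K G, symb Φ 1 x ∈ S := by
      intro x hx
      unfold aug augS at hx
      induction hx using Submodule.span_induction with
      | mem x hx =>
        obtain ⟨g, _, rfl⟩ := hx
        exact Submodule.subset_span ⟨g, rfl⟩
      | zero => rw [(symb_eq_zero (zero_mem _)).mpr (zero_mem _)]; exact zero_mem _
      | add x y hx hy h1 h2 =>
        rw [symb_add (augFilt_one K _ hx) (augFilt_one K _ hy)]
        exact add_mem h1 h2
      | smul a x hx h =>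
        rw [symb_smul _ (augFilt_one K _ hx)]
        exact Submodule.smul_mem _ _ h
    have h2 : ∀ k : ℕ, ∀ x ∈ aug K G ^ k, symb Φ k x ∈ S ^ k := by
      intro k
      induction k with
      | zero =>
        intro x hx
        rw [pow_zero] at hx ⊢
        obtain ⟨a, rfl⟩ := Submodule.mem_one.mp hx
        rw [Algebra.algebraMap_eq_smul_one, symb_smul _ (augFilt_zero K _), symb_one]
        exact Submodule.smul_mem _ _ (Submodule.one_le.mp le_rfl)
      | succ k ih =>
        intro x hx
        have hx' := hx
        rw [pow_succ] at hx
        induction hx using Submodule.mul_induction_on' with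
        | mem_mul_mem a ha b hb =>
          rw [← symb_mul (aug_pow_le K k ha) (augFilt_one K b hb), pow_succ]
          exact Submodule.mul_mem_mul (ih a ha) (h1 b hb)
        | add a ha b hb h3 h4 =>
          rw [← pow_succ] at ha hb
          rw [symb_add (aug_pow_le K _ ha) (aug_pow_le K _ hb)]
          exact add_mem (h3 ha) (h4 hb)
    have h3 : aug K G ^ c ≤ aug K G ^ (c + 1) := by
      intro x hx
      have := h2 c x hx
      rw [hc, Submodule.mem_bot, symb_eq_zero (aug_pow_le K c hx),
        augFilt_of_pos K (Nat.succ_pos c)] at this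
      exact this
    have h4 : ∀ k : ℕ, aug K G ^ c ≤ aug K G ^ (c + k) := by
      intro k
      induction k with
      | zero => exact le_rfl
      | succ k ih =>
        refine ih.trans ?_
        rw [pow_add, ← add_assoc, add_right_comm, pow_add _ (c + 1)]
        exact mul_le_mul_left h3 _
    obtain ⟨k, hk⟩ := aug_nil K p hG
    have h5 : aug K G ^ c = ⊥ := by
      have := h4 k
      rwa [pow_add, hk, Submodule.mul_bot, le_bot_iff] at this
    have h6 : aug K G ^ (p ^ q) = ⊥ := by
      obtain ⟨t, ht⟩ := Nat.exists_eq_add_of_le hq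
      rw [ht, pow_add, h5, Submodule.bot_mul]
    have h7 : (ug K g - 1) ^ (p ^ q) ∈ aug K G ^ (p ^ q) := Submodule.pow_mem_pow _ (mem_aug K g) _
    rw [h6, Submodule.mem_bot, sub_one_pow, sub_eq_zero, ← ug_one K] at h7
    exact ug_inj K h7

end GrD

end FrobExp

namespace FrobExp

open scoped commutatorElement

section Grp

variable {W G : Type*} [Group W] [Group G]

lemma fpf_mem [Finite G] (α : MulAut G) (hα : ∀ x, α x = x → x = 1) (N : Subgroup G)
    (hN : ∀ x ∈ N, α x ∈ N) (x : G) (hx : x⁻¹ * α x ∈ N) : x ∈ N := by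
  have inj : ∀ m n : G, n⁻¹ * α n = m⁻¹ * α m → n = m := by
    intro m n h
    have : α (m * n⁻¹) = m * n⁻¹ := by
      have h2 : α n = n * (m⁻¹ * α m) := by rw [← h]; group
      rw [map_mul, map_inv, h2]; group
    have := hα _ this
    rw [mul_inv_eq_one] at this
    exact this.symm
  let θ : N → N := fun n => ⟨(n : G)⁻¹ * α n, N.mul_mem (N.inv_mem n.2) (hN _ n.2)⟩
  have hθ : Function.Injective θ := by
    intro n m h
    exact Subtype.ext (inj _ _ (congrArg Subtype.val h))
  obtain ⟨n, hn⟩ := Finite.surjective_of_injective hθ ⟨_, hx⟩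
  have := inj _ _ (congrArg Subtype.val hn)
  rw [← this]; exact n.2

/-- A partially additive equivariant map. -/
structure Tau {A : Type*} [AddCommGroup A] (φ : W →* MulAut G) (E : Subgroup G) (τ : G → A)
    (ψ : W → A →+ A) : Prop where
  inv : ∀ w, ∀ x ∈ E, φ w x ∈ E
  add : ∀ x ∈ E, ∀ y ∈ E, τ (x * y) = τ x + τ y
  eqv : ∀ w, ∀ x ∈ E, ψ w (τ x) = τ (φ w x)

namespace Tau

variable {A : Type*} [AddCommGroup A] {φ : W →* MulAut G} {E : Subgroup G} {τ : G → A}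
  {ψ : W → A →+ A}

lemma one (T : Tau φ E τ ψ) : τ 1 = 0 := by
  have := T.add 1 E.one_mem 1 E.one_mem
  rw [one_mul] at this
  exact left_eq_add.mp this

lemma neg (T : Tau φ E τ ψ) (x : G) (hx : x ∈ E) : τ x⁻¹ = - τ x := by
  have := T.add x⁻¹ (E.inv_mem hx) x hx
  rw [inv_mul_cancel, T.one] at this
  exact eq_neg_of_add_eq_zero_left this.symm

lemma im (T : Tau φ E τ ψ) : ∃ A0 : AddSubgroup A, ∀ x, x ∈ A0 ↔ ∃ g ∈ E, τ g = x :=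
  ⟨{ carrier := {x | ∃ g ∈ E, τ g = x}
     zero_mem' := ⟨1, E.one_mem, T.one⟩
     add_mem' := by
      rintro _ _ ⟨g, hg, rfl⟩ ⟨h, hh, rfl⟩
      exact ⟨g * h, E.mul_mem hg hh, T.add g hg h hh⟩
     neg_mem' := by
      rintro _ ⟨g, hg, rfl⟩
      exact ⟨g⁻¹, E.inv_mem hg, T.neg g hg⟩ }, fun _ => Iff.rfl⟩

lemma ker (T : Tau φ E τ ψ) : ∃ N : Subgroup G, ∀ x, x ∈ N ↔ x ∈ E ∧ τ x = 0 :=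
  ⟨{ carrier := {x | x ∈ E ∧ τ x = 0}
     one_mem' := ⟨E.one_mem, T.one⟩
     mul_mem' := by
      rintro g h ⟨hg, hg'⟩ ⟨hh, hh'⟩
      exact ⟨E.mul_mem hg hh, by rw [T.add g hg h hh, hg', hh', add_zero]⟩
     inv_mem' := by
      rintro g ⟨hg, hg'⟩
      exact ⟨E.inv_mem hg, by rw [T.neg g hg, hg', neg_zero]⟩ }, fun _ => Iff.rfl⟩

lemma act_mul (T : Tau φ E τ ψ) (v w : W) (x : G) (hx : x ∈ E) : ψ (v * w) (τ x) = ψ v (ψ w (τ x)) := by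
  rw [T.eqv _ x hx, T.eqv _ x hx, T.eqv _ _ (T.inv w x hx), map_mul]; rfl

lemma sumF (T : Tau φ E τ ψ) [Finite G] {F : Subgroup W} [Fintype F] {a : W} (ha : a ∈ F)
    (hα : ∀ x, φ a x = x → x = 1) (g : G) (hg : g ∈ E) : ∑ f : F, ψ f (τ g) = 0 := by
  obtain ⟨A0, hA0⟩ := T.im
  obtain ⟨N, hN⟩ := T.ker
  have hmem : ∑ f : F, ψ f (τ g) ∈ A0 := by
    refine sum_mem fun f _ => (hA0 _).mpr ⟨φ f g, T.inv _ _ hg, (T.eqv _ _ hg).symm⟩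
  obtain ⟨m, hm, e⟩ := (hA0 _).mp hmem
  have hfix : ψ a (τ m) = τ m := by
    rw [e, map_sum]
    rw [← Equiv.sum_comp (Equiv.mulLeft (⟨a, ha⟩ : F)) (fun f : F => ψ f (τ g))]
    refine Finset.sum_congr rfl fun f _ => ?_
    rw [← T.act_mul _ _ _ hg]; rfl
  have : m ∈ N := by
    refine fpf_mem (φ a) hα N ?_ m ?_
    · intro x hx
      obtain ⟨h1, h2⟩ := (hN x).mp hx
      exact (hN _).mpr ⟨T.inv _ _ h1, by rw [← T.eqv _ _ h1, h2, map_zero]⟩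
    · refine (hN _).mpr ⟨E.mul_mem (E.inv_mem hm) (T.inv _ _ hm), ?_⟩
      rw [T.add _ (E.inv_mem hm) _ (T.inv _ _ hm), T.neg _ hm, ← T.eqv _ _ hm, hfix]
      abel
  rw [← e]; exact ((hN m).mp this).2

/-- The cocycle lemma. -/
lemma cocycle (T : Tau φ E τ ψ) [Finite G] {F H : Subgroup W} [Fintype F] [Fintype H] [F.Normal]
    (hfr : ∀ h ∈ H, h ≠ 1 → ∀ g ∈ F, h * g = g * h → g = 1) {a : W} (ha : a ∈ F)
    (hα : ∀ x, φ a x = x → x = 1) (z : W → A) (hz : ∀ k ∈ H, ∃ g ∈ E, τ g = z k)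
    (hc : ∀ k ∈ H, ∀ h ∈ H, z (k * h) = z k + ψ k (z h)) :
    ∃ u ∈ E, ∀ k ∈ H, z k = ψ k (τ u) - τ u := by
  classical
  obtain ⟨A0, hA0⟩ := T.im
  have hz0 : ∀ k ∈ H, z k ∈ A0 := fun k hk => (hA0 _).mpr (hz k hk)
  have hψ0 : ∀ w, ∀ x ∈ A0, ψ w x ∈ A0 := by
    intro w x hx
    obtain ⟨g, hg, rfl⟩ := (hA0 x).mp hx
    exact (hA0 _).mpr ⟨φ w g, T.inv _ _ hg, (T.eqv _ _ hg).symm⟩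
  have hψm : ∀ v w, ∀ x ∈ A0, ψ (v * w) x = ψ v (ψ w x) := by
    intro v w x hx
    obtain ⟨g, hg, rfl⟩ := (hA0 x).mp hx
    exact T.act_mul v w g hg
  have key : ∀ n : ℕ, ∀ S : Finset W, S.card ≤ n → (∀ f ∈ S, f ∈ F ∧ f ≠ 1) →
      (∀ f ∈ S, ∀ h ∈ H, h * f * h⁻¹ ∈ S) →
      ∃ u ∈ A0, ∀ k ∈ H, ψ k u - u = ∑ f ∈ S, ψ f (z k) := by
    intro n
    induction n with
    | zero =>
      intro S hS _ _
      have : S = ∅ := by simpa using hS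
      subst this
      exact ⟨0, zero_mem _, fun k _ => by simp⟩
    | succ n ih =>
      intro S hS hF hinv
      rcases S.eq_empty_or_nonempty with rfl | ⟨f0, hf0⟩
      · exact ⟨0, zero_mem _, fun k _ => by simp⟩
      have hinj : Function.Injective (fun h : H => (h : W) * f0 * (h : W)⁻¹) := by
        intro h k e
        by_contra hne
        simp only at e
        refine (hF f0 hf0).2 (hfr ((k : W)⁻¹ * h) (H.mul_mem (H.inv_mem k.2) h.2) ?_ f0
          (hF f0 hf0).1 ?_)
        · intro h1
          apply hne
          rw [inv_mul_eq_one] at h1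
          exact Subtype.ext h1.symm
        · have : (h : W) * f0 = k * f0 * (k : W)⁻¹ * h := by rw [← e]; group
          rw [mul_assoc, this]; group
      set O : Finset W := Finset.univ.image (fun h : H => (h : W) * f0 * (h : W)⁻¹) with hO
      have hOS : O ⊆ S := by
        intro x hx
        obtain ⟨h, _, rfl⟩ := Finset.mem_image.mp hx
        exact hinv f0 hf0 h h.2
      have hf0O : f0 ∈ O := Finset.mem_image.mpr ⟨1, Finset.mem_univ _, by simp⟩
      obtain ⟨u, hu0, hu⟩ := ih (S \ O) (by
          have : (S \ O).card < S.card := Finset.card_lt_card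
            ⟨Finset.sdiff_subset, fun h => (Finset.mem_sdiff.mp (h hf0)).2 hf0O⟩
          omega)
        (fun f hf => hF f (Finset.mem_sdiff.mp hf).1) (by
          intro f hf h hh
          obtain ⟨h1, h2⟩ := Finset.mem_sdiff.mp hf
          refine Finset.mem_sdiff.mpr ⟨hinv f h1 h hh, fun h3 => h2 ?_⟩
          obtain ⟨k, _, hk⟩ := Finset.mem_image.mp h3
          refine Finset.mem_image.mpr ⟨⟨h⁻¹ * k, H.mul_mem (H.inv_mem hh) k.2⟩, Finset.mem_univ _, ?_⟩
          simp only at hk ⊢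
          have : f = h⁻¹ * (h * f * h⁻¹) * h := by group
          rw [this, ← hk]; group)
      refine ⟨u + ∑ h : H, ψ (h * f0) (z (h : W)⁻¹), add_mem hu0
        (sum_mem fun h _ => hψ0 _ _ (hz0 _ (H.inv_mem h.2))), fun k hk => ?_⟩
      have e1 : ψ k (∑ h : H, ψ (h * f0) (z (h : W)⁻¹)) =
          ∑ h : H, ψ (h * f0) (z (h : W)⁻¹) + ∑ f ∈ O, ψ f (z k) := by
        rw [map_sum, ← Equiv.sum_comp (Equiv.mulLeft (⟨k, hk⟩ : H)⁻¹), hO,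
          Finset.sum_image (fun x _ y _ h => hinj h), ← Finset.sum_add_distrib]
        refine Finset.sum_congr rfl fun h _ => ?_
        have h1 : (((Equiv.mulLeft (⟨k, hk⟩ : H)⁻¹) h : H) : W) = k⁻¹ * h := rfl
        rw [h1, ← hψm _ _ _ (hz0 _ (H.inv_mem (H.mul_mem (H.inv_mem hk) h.2))), mul_inv_rev, inv_inv,
          hc _ (H.inv_mem h.2) _ hk, map_add, ← mul_assoc, ← mul_assoc, mul_inv_cancel, one_mul,
          ← hψm _ _ _ (hz0 _ hk)]
      rw [map_add, e1, ← Finset.sum_sdiff hOS, ← hu k hk]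
      abel
  obtain ⟨u, hu0, hu⟩ := key _ (Finset.univ.image (fun f : F => (f : W)) |>.erase 1) le_rfl (by
    intro f hf
    obtain ⟨h1, h2⟩ := Finset.mem_erase.mp hf
    obtain ⟨f, _, rfl⟩ := Finset.mem_image.mp h2
    exact ⟨f.2, h1⟩) (by
    intro f hf h hh
    obtain ⟨h1, h2⟩ := Finset.mem_erase.mp hf
    obtain ⟨f, _, rfl⟩ := Finset.mem_image.mp h2
    refine Finset.mem_erase.mpr ⟨?_, Finset.mem_image.mpr
      ⟨⟨_, Subgroup.Normal.conj_mem (inferInstance : F.Normal) f f.2 h⟩, Finset.mem_univ _, rfl⟩⟩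
    rwa [Ne, conj_eq_one_iff])
  obtain ⟨v, hv, e⟩ := (hA0 _).mp (neg_mem hu0)
  refine ⟨v, hv, fun k hk => ?_⟩
  obtain ⟨g, hg, hgz⟩ := hz k hk
  have h1 : ∑ f : F, ψ f (z k) = 0 := by rw [← hgz]; exact T.sumF ha hα g hg
  have hmem : (1 : W) ∈ Finset.univ.image (fun f : F => (f : W)) :=
    Finset.mem_image.mpr ⟨1, Finset.mem_univ _, rfl⟩
  have h2 := Finset.add_sum_erase _ (fun f => ψ f (z k)) hmem
  rw [Finset.sum_image (fun x _ y _ h => Subtype.ext h), h1, ← hu k hk] at h2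
  have h3 : ψ 1 (z k) = z k := by rw [← hgz, T.eqv _ _ hg, map_one]; rfl
  rw [h3] at h2
  rw [e, map_neg]
  rw [eq_neg_of_add_eq_zero_left h2]
  abel

end Tau

/-- one step of the lifting -/
lemma lift_step [Finite G] (φ : W →* MulAut G) {F H : Subgroup W} [Finite W] [F.Normal]
    (hfr : ∀ h ∈ H, h ≠ 1 → ∀ g ∈ F, h * g = g * h → g = 1) {a : W} (ha : a ∈ F)
    (hα : ∀ x, φ a x = x → x = 1) (M : Subgroup G) (hM : ∀ w, ∀ x ∈ M, φ w x ∈ M)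
    (x : G) (hx : ∀ h ∈ H, x⁻¹ * φ h x ∈ M) :
    ∃ y, x⁻¹ * y ∈ M ∧ ∀ h ∈ H, y⁻¹ * φ h y ∈ ⁅M, M⁆ := by
  classical
  have := Fintype.ofFinite F
  have := Fintype.ofFinite H
  let τ : G → Additive (Abelianization M) := fun g =>
    if h : g ∈ M then Additive.ofMul (Abelianization.of ⟨g, h⟩) else 0
  let r : W → (M →* M) := fun w => ((φ w).toMonoidHom.comp M.subtype).codRestrict M
    (fun x => hM w x x.2)
  let ψ : W → Additive (Abelianization M) →+ Additive (Abelianization M) := fun w =>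
    MonoidHom.toAdditive (Abelianization.map (r w))
  have hτ : ∀ g (h : g ∈ M), τ g = Additive.ofMul (Abelianization.of ⟨g, h⟩) := fun g h => dif_pos h
  have T : Tau φ M τ ψ := by
    refine ⟨hM, ?_, ?_⟩
    · intro x hx y hy
      rw [hτ x hx, hτ y hy, hτ _ (M.mul_mem hx hy), ← ofMul_mul, ← map_mul]; rfl
    · intro w x hx
      rw [hτ x hx, hτ _ (hM w x hx)]
      rfl
  have hker : ∀ g ∈ M, τ g = 0 → g ∈ ⁅M, M⁆ := by
    intro g hg h
    rw [hτ g hg] at h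
    have h2 : (⟨g, hg⟩ : M) ∈ (Abelianization.of : M →* _).ker := h
    rw [Abelianization.ker_of, commutator_def] at h2
    have h3 : g ∈ Subgroup.map M.subtype ⁅(⊤ : Subgroup M), (⊤ : Subgroup M)⁆ := ⟨_, h2, rfl⟩
    rwa [Subgroup.map_commutator, ← MonoidHom.range_eq_map, Subgroup.range_subtype] at h3
  obtain ⟨u, hu, hu2⟩ := T.cocycle hfr ha hα (fun k => τ (x⁻¹ * φ k x))
    (fun k hk => ⟨_, hx k hk, rfl⟩) (by
      intro k hk h hh
      rw [T.eqv _ _ (hx h hh), ← T.add _ (hx k hk) _ (hM _ _ (hx h hh))]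
      congr 1
      rw [map_mul φ, MulAut.mul_apply, map_mul, map_inv]
      group)
  refine ⟨x * u⁻¹, by simpa using hu, fun h hh => hker _ ?_ ?_⟩
  · have : (x * u⁻¹)⁻¹ * φ h (x * u⁻¹) = u * (x⁻¹ * φ h x) * (φ h u)⁻¹ := by
      rw [map_mul, map_inv]; group
    rw [this]
    exact M.mul_mem (M.mul_mem hu (hx h hh)) (M.inv_mem (hM _ _ hu))
  · have : (x * u⁻¹)⁻¹ * φ h (x * u⁻¹) = u * (x⁻¹ * φ h x) * (φ h u)⁻¹ := by
      rw [map_mul, map_inv]; group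
    rw [this, T.add _ (M.mul_mem hu (hx h hh)) _ (M.inv_mem (hM _ _ hu)), T.add _ hu _ (hx h hh),
      T.neg _ (hM _ _ hu), ← T.eqv _ _ hu]
    have := hu2 h hh
    rw [this]; abel

lemma lift_fixed [Finite G] [Group.IsSolvable G] (φ : W →* MulAut G) {F H : Subgroup W} [Finite W]
    [F.Normal] (hfr : ∀ h ∈ H, h ≠ 1 → ∀ g ∈ F, h * g = g * h → g = 1) {a : W} (ha : a ∈ F)
    (hα : ∀ x, φ a x = x → x = 1) (M : Subgroup G) (hM : ∀ w, ∀ x ∈ M, φ w x ∈ M)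
    (x : G) (hx : ∀ h ∈ H, x⁻¹ * φ h x ∈ M) :
    ∃ y, x⁻¹ * y ∈ M ∧ ∀ h ∈ H, φ h y = y := by
  obtain ⟨s, hs⟩ := (inferInstance : Group.IsSolvable G).solvable
  have key : ∀ s i : ℕ, derivedSeries G (i + s) = ⊥ → ∀ M : Subgroup G, M ≤ derivedSeries G i →
      (∀ w, ∀ x ∈ M, φ w x ∈ M) → ∀ x, (∀ h ∈ H, x⁻¹ * φ h x ∈ M) →
      ∃ y, x⁻¹ * y ∈ M ∧ ∀ h ∈ H, φ h y = y := by
    intro s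
    induction s with
    | zero =>
      intro i hi M hMi hM x hx
      refine ⟨x, by simp, fun h hh => ?_⟩
      have := hMi (hx h hh)
      rw [add_zero] at hi
      rw [hi, Subgroup.mem_bot, inv_mul_eq_one] at this
      exact this.symm
    | succ s ih =>
      intro i hi M hMi hM x hx
      obtain ⟨y, hy, hy2⟩ := lift_step φ hfr ha hα M hM x hx
      have hle : ⁅M, M⁆ ≤ M := Subgroup.commutator_le_self M
      obtain ⟨y', h1, h2⟩ := ih (i + 1) (by rw [← hi]; congr 1; omega) ⁅M, M⁆
        (by rw [derivedSeries_succ]; exact Subgroup.commutator_mono hMi hMi) (by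
          intro w x hx
          have h3 : φ w x ∈ Subgroup.map (φ w).toMonoidHom ⁅M, M⁆ := ⟨x, hx, rfl⟩
          rw [Subgroup.map_commutator] at h3
          have h4 : M.map (φ w).toMonoidHom ≤ M := by
            rintro _ ⟨z, hz, rfl⟩
            exact hM w z hz
          exact Subgroup.commutator_mono h4 h4 h3) y hy2
      refine ⟨y', ?_, h2⟩
      have : x⁻¹ * y' = (x⁻¹ * y) * (y⁻¹ * y') := by group
      rw [this]
      exact M.mul_mem hy (hle h1)
  exact key s 0 (by rwa [zero_add]) M (by simp) hM x hx

lemma Tau.spanning [Finite G] [Group.IsSolvable G] {A : Type*} [AddCommGroup A]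
    {φ : W →* MulAut G} {E : Subgroup G} {τ : G → A}
    {ψ : W → A →+ A} (T : Tau φ E τ ψ) {F H : Subgroup W} [Finite W]
    [F.Normal] (hfr : ∀ h ∈ H, h ≠ 1 → ∀ g ∈ F, h * g = g * h → g = 1) {a : W} (ha : a ∈ F)
    (hα : ∀ x, φ a x = x → x = 1) (g : G) (hg : g ∈ E) :
    Nat.card F • τ g ∈ AddSubgroup.closure
      {t | ∃ y ∈ E, ∃ f ∈ F, (∀ h ∈ H, φ h y = y) ∧ t = τ (φ f y)} := by
  classical
  have := Fintype.ofFinite F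
  have := Fintype.ofFinite H
  obtain ⟨A0, hA0⟩ := T.im
  obtain ⟨N, hN⟩ := T.ker
  have h1 : Nat.card F • τ g = ∑ f : F, ∑ h : H, ψ ((f : W)⁻¹ * h * f) (τ g) := by
    rw [Finset.sum_comm, ← Finset.add_sum_erase _ _ (Finset.mem_univ (1 : H))]
    refine Eq.trans ?_ (congrArg₂ (· + ·) rfl (Finset.sum_eq_zero ?_).symm)
    · rw [add_zero]
      have : ∀ f : F, ψ ((f : W)⁻¹ * (1 : H) * f) (τ g) = τ g := by
        intro f
        simp [T.eqv _ _ hg]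
      rw [Finset.sum_congr rfl (fun f _ => this f), Finset.sum_const, Finset.card_univ,
        Nat.card_eq_fintype_card]
    · intro h hh
      have hh1 : (h : W) ≠ 1 := fun e => (Finset.mem_erase.mp hh).1 (Subtype.ext e)
      let c : F → F := fun f => ⟨(h : W)⁻¹ * (f : W)⁻¹ * h * f, F.mul_mem (by
        have := Subgroup.Normal.conj_mem (inferInstance : F.Normal) _ (F.inv_mem f.2) (h : W)⁻¹
        rwa [inv_inv] at this) f.2⟩
      have hc : Function.Bijective c := by
        refine Finite.injective_iff_bijective.mp ?_
        intro f k e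
        have e1 : (h : W)⁻¹ * (f : W)⁻¹ * h * f = (h : W)⁻¹ * (k : W)⁻¹ * h * k :=
          congrArg Subtype.val e
        have e2 := hfr h h.2 hh1 ((k : W) * (f : W)⁻¹) (F.mul_mem k.2 (F.inv_mem f.2)) (by
          have e3 : (f : W)⁻¹ * h * f = (k : W)⁻¹ * h * k := by
            have := congrArg (fun t => (h : W) * t) e1
            simpa [mul_assoc] using this
          calc (h : W) * (k * (f : W)⁻¹) = k * ((k : W)⁻¹ * h * k) * (f : W)⁻¹ := by group
            _ = k * ((f : W)⁻¹ * h * f) * (f : W)⁻¹ := by rw [e3]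
            _ = _ := by group)
        rw [mul_inv_eq_one] at e2
        exact Subtype.ext e2.symm
      have e4 : ∀ f : F, ψ ((f : W)⁻¹ * h * f) (τ g) = ψ h (ψ (c f : W) (τ g)) := by
        intro f
        rw [← T.act_mul _ _ _ hg]
        congr 2
        simp only [c]; group
      rw [Finset.sum_congr rfl (fun f _ => e4 f), ← map_sum,
        Function.Bijective.sum_comp hc (fun f : F => ψ (f : W) (τ g)), T.sumF ha hα g hg, map_zero]
  rw [h1]
  refine sum_mem fun f _ => AddSubgroup.subset_closure ?_
  set v := ∑ h : H, ψ h (τ (φ f g)) with hv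
  have hfg := T.inv (f : W) g hg
  have hvA : v ∈ A0 := sum_mem fun h _ =>
    (hA0 _).mpr ⟨φ h (φ f g), T.inv _ _ hfg, (T.eqv _ _ hfg).symm⟩
  obtain ⟨x, hx, hxv⟩ := (hA0 _).mp hvA
  have hfix : ∀ h ∈ H, ψ h v = v := by
    intro k hk
    rw [hv, map_sum, ← Equiv.sum_comp (Equiv.mulLeft (⟨k, hk⟩ : H)) (fun h : H => ψ h (τ (φ f g)))]
    refine Finset.sum_congr rfl fun h _ => ?_
    rw [← T.act_mul _ _ _ hfg]; rfl
  obtain ⟨y, hy, hyf⟩ := lift_fixed φ hfr ha hα N (by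
      intro w x hx
      obtain ⟨h1, h2⟩ := (hN x).mp hx
      exact (hN _).mpr ⟨T.inv _ _ h1, by rw [← T.eqv _ _ h1, h2, map_zero]⟩) x (by
      intro h hh
      refine (hN _).mpr ⟨E.mul_mem (E.inv_mem hx) (T.inv _ _ hx), ?_⟩
      rw [T.add _ (E.inv_mem hx) _ (T.inv _ _ hx), T.neg _ hx, ← T.eqv _ _ hx, hxv, hfix h hh]
      abel)
  obtain ⟨hy1, hy2⟩ := (hN _).mp hy
  have hyE : y ∈ E := by
    have := E.mul_mem hx hy1
    rwa [mul_inv_cancel_left] at this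
  have hτy : τ y = v := by
    rw [T.add _ (E.inv_mem hx) _ hyE, T.neg _ hx, hxv] at hy2
    exact (neg_add_eq_zero.mp hy2).symm
  refine ⟨y, hyE, (f : W)⁻¹, F.inv_mem f.2, hyf, ?_⟩
  rw [← T.eqv _ _ hyE, hτy, hv, map_sum]
  refine Finset.sum_congr rfl fun h _ => ?_
  rw [← T.eqv _ _ hg, ← T.act_mul _ _ _ hg]
  rw [← T.act_mul _ _ _ hg, mul_assoc]

end Grp

end FrobExp

namespace FrobExp

section Split

variable {K : Type*} [Field K] {A : Type*} [Ring A] [Algebra K A]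

attribute [local instance] LieRing.ofAssociativeRing

lemma iter_le_iSup {n : ℕ} [NeZero n] (s : ℕ) : ∀ (M : Submodule K A) (V : ZMod n → Submodule K A),
    M ≤ ⨆ i, V i → (fun M => br M M)^[s] M ≤ ⨆ i, ((brFam (K := K) (L := A) (n := n))^[s] V) i := by
  induction s with
  | zero => intro M V h; exact h
  | succ s ih =>
    intro M V h
    rw [Function.iterate_succ_apply, Function.iterate_succ_apply]
    refine ih _ _ ?_
    rw [br_le]
    intro x hx y hy
    replace hx := h hx
    replace hy := h hy
    induction hx using Submodule.iSup_induction' with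
    | mem i x hx =>
      induction hy using Submodule.iSup_induction' with
      | mem j y hy =>
        refine Submodule.mem_iSup_of_mem (i + j) (Submodule.subset_span ?_)
        exact ⟨i, j, x, y, rfl, hx, hy, rfl⟩
      | zero => simp
      | add y z _ _ h1 h2 =>
        have : x * (y + z) - (y + z) * x = (x * y - y * x) + (x * z - z * x) := by noncomm_ring
        rw [this]; exact add_mem h1 h2
    | zero => simp
    | add x z _ _ h1 h2 =>
      have : (x + z) * y - y * (x + z) = (x * y - y * x) + (z * y - y * z) := by noncomm_ring
      rw [this]; exact add_mem h1 h2

lemma br_iter_bot {n : ℕ} [NeZero n] {ω : K} (hω : IsPrimitiveRoot ω n) (hn : (n : K) ≠ 0)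
    (Φ : A →ₐ[K] A) (M : Submodule K A) (hbr : br M M ≤ M) (hΦ : ∀ x ∈ M, Φ x ∈ M)
    (hord : ∀ x ∈ M, (Φ^[n]) x = x) (hfix : ∀ x ∈ M, Φ x = x → x = 0) (m : ℕ) (hm : n ≤ m) :
    (fun M => br M M)^[2 ^ m - 1] M = ⊥ := by
  have hn0 : 0 < n := Nat.pos_of_ne_zero (NeZero.ne n)
  have hω0 : ω ≠ 0 := hω.ne_zero hn0.ne'
  let V : ZMod n → Submodule K A := fun i =>
    { carrier := {x | x ∈ M ∧ Φ x = ω ^ i.val • x}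
      zero_mem' := ⟨zero_mem _, by simp⟩
      add_mem' := by
        rintro x y ⟨h1, h2⟩ ⟨h3, h4⟩
        exact ⟨add_mem h1 h3, by rw [map_add, h2, h4, smul_add]⟩
      smul_mem' := by
        rintro c x ⟨h1, h2⟩
        exact ⟨M.smul_mem c h1, by rw [map_smul, h2, smul_comm]⟩ }
  have memV : ∀ i x, x ∈ V i ↔ x ∈ M ∧ Φ x = ω ^ i.val • x := fun i x => Iff.rfl
  have hV : GrFam (K := K) (L := A) V := by
    refine ⟨?_, ?_⟩
    · intro a b x y hx hy
      obtain ⟨hx1, hx2⟩ := (memV _ _).mp hx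
      obtain ⟨hy1, hy2⟩ := (memV _ _).mp hy
      refine (memV _ _).mpr ⟨hbr (mem_br hx1 hy1), ?_⟩
      have : ω ^ (a + b).val = ω ^ a.val * ω ^ b.val := by
        rw [ZMod.val_add, ← pow_add, ← pow_eq_pow_mod _ hω.pow_eq_one]
      rw [LieRing.of_associative_ring_bracket, map_sub, map_mul, map_mul, hx2, hy2, this]
      simp only [smul_mul_smul_comm, smul_sub]
      rw [mul_comm (ω ^ b.val)]
    · rw [eq_bot_iff]
      intro x hx
      obtain ⟨hx1, hx2⟩ := (memV _ _).mp hx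
      rw [ZMod.val_zero, pow_zero, one_smul] at hx2
      exact (Submodule.mem_bot K).mpr (hfix x hx1 hx2)
  have hM : M ≤ ⨆ i, V i := by
    intro x hx
    have hit : ∀ j, (Φ^[j]) x ∈ M := by
      intro j
      induction j with
      | zero => exact hx
      | succ j ih => rw [Function.iterate_succ_apply']; exact hΦ _ ih
    let y : ℕ → A := fun i => ∑ j ∈ Finset.range n, ((ω⁻¹) ^ i) ^ j • (Φ^[j]) x
    have hy : ∀ i ∈ Finset.range n, y i ∈ ⨆ i, V i := by
      intro i hi
      have hi' : i < n := Finset.mem_range.mp hi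
      refine Submodule.mem_iSup_of_mem (i : ZMod n) ((memV _ _).mpr ⟨?_, ?_⟩)
      · exact sum_mem fun j _ => M.smul_mem _ (hit j)
      · rw [ZMod.val_cast_of_lt hi']
        have h1 : ∀ j, Φ (((ω⁻¹) ^ i) ^ j • (Φ^[j]) x) =
            ω ^ i • (((ω⁻¹) ^ i) ^ (j + 1) • (Φ^[j + 1]) x) := by
          intro j
          rw [map_smul, Function.iterate_succ_apply', smul_smul]
          congr 1
          rw [pow_succ, mul_comm, mul_assoc, ← mul_pow, inv_mul_cancel₀ hω0, one_pow, mul_one]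
        have h2 : ∑ j ∈ Finset.range n, ((ω⁻¹) ^ i) ^ (j + 1) • (Φ^[j + 1]) x = y i := by
          have e1 := Finset.sum_range_succ (fun j => ((ω⁻¹) ^ i) ^ j • (Φ^[j]) x) n
          have e2 := Finset.sum_range_succ' (fun j => ((ω⁻¹) ^ i) ^ j • (Φ^[j]) x) n
          have e3 : ((ω⁻¹) ^ i) ^ n = 1 := by
            rw [← pow_mul, mul_comm, pow_mul, inv_pow, hω.pow_eq_one, inv_one, one_pow]
          rw [e1, hord x hx, e3] at e2
          simp only [pow_zero, Function.iterate_zero, id] at e2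
          exact (add_right_cancel e2).symm
        change Φ (∑ j ∈ Finset.range n, ((ω⁻¹) ^ i) ^ j • (Φ^[j]) x) = _
        rw [map_sum, Finset.sum_congr rfl (fun j _ => h1 j), ← Finset.smul_sum, h2]
    have hsum : ∑ i ∈ Finset.range n, y i = (n : K) • x := by
      simp only [y]
      rw [Finset.sum_comm, Finset.sum_eq_single_of_mem 0 (Finset.mem_range.mpr hn0)]
      · simp [Nat.cast_smul_eq_nsmul]
      · intro j hj hj0
        rw [← Finset.sum_smul]
        have : ∑ i ∈ Finset.range n, ((ω⁻¹) ^ i) ^ j = 0 := by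
          have e1 : ∀ i, ((ω⁻¹) ^ i) ^ j = ((ω⁻¹) ^ j) ^ i := fun i => by
            rw [← pow_mul, mul_comm, pow_mul]
          rw [Finset.sum_congr rfl (fun i _ => e1 i)]
          have e2 := geom_sum_mul ((ω⁻¹) ^ j) n
          have e3 : ((ω⁻¹) ^ j) ^ n = 1 := by
            rw [← pow_mul, mul_comm, pow_mul, inv_pow, hω.pow_eq_one, inv_one, one_pow]
          rw [e3, sub_self] at e2
          rcases mul_eq_zero.mp e2 with h | h
          · exact h
          · exfalso
            rw [sub_eq_zero, inv_pow, inv_eq_one] at h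
            have := (hω.pow_eq_one_iff_dvd j).mp h
            exact hj0 (Nat.eq_zero_of_dvd_of_lt this (Finset.mem_range.mp hj))
        rw [this, zero_smul]
    have : x = (n : K)⁻¹ • ∑ i ∈ Finset.range n, y i := by
      rw [hsum, smul_smul, inv_mul_cancel₀ hn, one_smul]
    rw [this]
    exact Submodule.smul_mem _ _ (sum_mem hy)
  have := iter_le_iSup (2 ^ m - 1) M V hM
  rw [← le_bot_iff]
  refine this.trans (iSup_le fun i => ?_)
  rw [kreknin (K := K) (L := A) V hV m hm i]

end Split

section M0

variable {K : Type*} [Field K] {A : Type*} [Ring A] [Algebra K A]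

variable (K) in
/-- The Lie subalgebra generated by a set. -/
def lgen (S : Set A) : Submodule K A := sInf {N | S ⊆ N ∧ br N N ≤ N}

lemma lgen_le {S : Set A} {N : Submodule K A} (h1 : S ⊆ N) (h2 : br N N ≤ N) : lgen K S ≤ N :=
  sInf_le ⟨h1, h2⟩

lemma subset_lgen (S : Set A) : S ⊆ lgen K S := by
  intro x hx
  simp only [lgen, SetLike.mem_coe, Submodule.mem_sInf]
  exact fun N hN => hN.1 hx

lemma br_lgen (S : Set A) : br (lgen K S) (lgen K S) ≤ lgen K S := by
  refine le_sInf fun N hN => ?_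
  have : lgen K S ≤ N := sInf_le hN
  exact (br_mono this this).trans hN.2

lemma lgen_le_sup (S : Set A) : lgen K S ≤ Submodule.span K S ⊔ br (lgen K S) (lgen K S) := by
  have h : Submodule.span K S ⊔ br (lgen K S) (lgen K S) ≤ lgen K S :=
    sup_le (Submodule.span_le.mpr (subset_lgen S)) (br_lgen S)
  exact lgen_le (Submodule.subset_span.trans (le_sup_left (a := Submodule.span K S)))
    ((br_mono h h).trans le_sup_right)

end M0

end FrobExp

namespace FrobExp

open scoped commutatorElement

section Core

variable {K A G : Type*} [Field K] [Ring A] [Algebra K A] [Group G] {p : ℕ}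
  (X : GrData K A G p) {W : Type*} [Group W] (φ : W →* MulAut G) (Θ : W → A →ₐ[K] A)

/-- Group-like elements of a subspace. -/
def GrData.gl (M : Submodule K A) : Set A :=
  {t | t ∈ M ∧ ∃ m g, 1 ≤ m ∧ g ∈ X.D m ∧ X.τ m g = t}

/-- Good subspaces. -/
structure Good (M : Submodule K A) : Prop where
  br_le : br M M ≤ M
  inv : ∀ w, ∀ x ∈ M, Θ w x ∈ M
  spn : M ≤ Submodule.span K (X.gl M)

lemma br_gl_le (M : Submodule K A) (hM : br M M ≤ M) :
    br (Submodule.span K (X.gl M)) (Submodule.span K (X.gl M)) ≤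
      Submodule.span K (X.gl (br M M)) := by
  rw [br_le]
  intro x hx y hy
  induction hx using Submodule.span_induction with
  | mem x hx =>
    induction hy using Submodule.span_induction with
    | mem y hy =>
      obtain ⟨hx1, m, g, hm, hg, rfl⟩ := hx
      obtain ⟨hy1, m', g', hm', hg', rfl⟩ := hy
      refine Submodule.subset_span ⟨mem_br hx1 hy1, m + m', ⁅g, g'⁆, by omega,
        X.comm_mem _ _ _ _ hg hg', (X.τ_comm _ _ _ _ hg hg').symm⟩
    | zero => simp
    | add y z _ _ h1 h2 =>
      have : x * (y + z) - (y + z) * x = (x * y - y * x) + (x * z - z * x) := by noncomm_ring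
      rw [this]; exact add_mem h1 h2
    | smul c y _ h =>
      rw [mul_smul_comm, smul_mul_assoc, ← smul_sub]
      exact Submodule.smul_mem _ _ h
  | zero => simp
  | add x z _ _ h1 h2 =>
    have : (x + z) * y - y * (x + z) = (x * y - y * x) + (z * y - y * z) := by noncomm_ring
    rw [this]; exact add_mem h1 h2
  | smul c x _ h =>
    rw [mul_smul_comm, smul_mul_assoc, ← smul_sub]
    exact Submodule.smul_mem _ _ h

variable {X φ Θ}

lemma Good.br {M : Submodule K A} (h : Good X Θ M) : Good X Θ (br M M) := by
  refine ⟨br_mono h.br_le h.br_le, ?_, ?_⟩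
  · intro w
    have : FrobExp.br M M ≤ (FrobExp.br M M).comap (Θ w).toLinearMap := by
      rw [FrobExp.br_le]
      intro x hx y hy
      change Θ w (x * y - y * x) ∈ FrobExp.br M M
      rw [map_sub, map_mul, map_mul]
      exact mem_br (h.inv w x hx) (h.inv w y hy)
    exact fun x hx => this hx
  · exact (br_mono h.spn h.spn).trans (br_gl_le X M h.br_le)

lemma GrData.τ_one (m : ℕ) (hm : 1 ≤ m) : X.τ m 1 = 0 := by
  have := X.τ_mul m 1 1 hm (X.D m).one_mem (X.D m).one_mem
  rw [one_mul] at this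
  exact left_eq_add.mp this

lemma GrData.τ_inv (m : ℕ) (hm : 1 ≤ m) (g : G) (hg : g ∈ X.D m) : X.τ m g⁻¹ = - X.τ m g := by
  have := X.τ_mul m g⁻¹ g hm ((X.D m).inv_mem hg) hg
  rw [inv_mul_cancel, X.τ_one m hm] at this
  exact eq_neg_of_add_eq_zero_left this.symm

lemma Good.tau (hΘ : ∀ w m g, g ∈ X.D m → Θ w (X.τ m g) = X.τ m (φ w g))
    {M : Submodule K A} (h : Good X Θ M) (m : ℕ) (hm : 1 ≤ m) :
    ∃ E : Subgroup G, (∀ g, g ∈ E ↔ g ∈ X.D m ∧ X.τ m g ∈ M) ∧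
      Tau φ E (X.τ m) (fun w => ((Θ w : A →ₐ[K] A) : A →+ A)) := by
  let E : Subgroup G :=
    { carrier := {g | g ∈ X.D m ∧ X.τ m g ∈ M}
      one_mem' := ⟨(X.D m).one_mem, by rw [X.τ_one m hm]; exact zero_mem _⟩
      mul_mem' := by
        rintro g g' ⟨h1, h2⟩ ⟨h3, h4⟩
        exact ⟨(X.D m).mul_mem h1 h3, by rw [X.τ_mul m _ _ hm h1 h3]; exact add_mem h2 h4⟩
      inv_mem' := by
        rintro g ⟨h1, h2⟩
        exact ⟨(X.D m).inv_mem h1, by rw [X.τ_inv m hm g h1]; exact neg_mem h2⟩ }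
  have memE : ∀ g, g ∈ E ↔ g ∈ X.D m ∧ X.τ m g ∈ M := fun g => Iff.rfl
  refine ⟨E, memE, ?_, ?_, ?_⟩
  · intro w g hg
    obtain ⟨h1, h2⟩ := (memE g).mp hg
    exact (memE _).mpr ⟨X.act_mem _ _ _ h1, by rw [← hΘ w m g h1]; exact h.inv w _ h2⟩
  · intro x hx y hy
    exact X.τ_mul m x y hm ((memE x).mp hx).1 ((memE y).mp hy).1
  · intro w x hx
    exact hΘ w m x ((memE x).mp hx).1

variable [Finite G] [Finite W] {F H : Subgroup W} [F.Normal]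

lemma Good.nil (hΘ : ∀ w m g, g ∈ X.D m → Θ w (X.τ m g) = X.τ m (φ w g))
    [Fact p.Prime] (hG : IsPGroup p G)
    (hfr : ∀ h ∈ H, h ≠ 1 → ∀ g ∈ F, h * g = g * h → g = 1) {a : W} (ha : a ∈ F)
    (hα : ∀ x, φ a x = x → x = 1) (hn : (Nat.card F : K) ≠ 0)
    {e : ℕ} (he0 : 0 < e) (he : ∀ x, (∀ h ∈ H, φ h x = x) → x ^ e = 1)
    {M : Submodule K A} (h : Good X Θ M) : M ≤ Submodule.span K {x | x ∈ M ∧ x ^ e = 0} := by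
  have : Group.IsNilpotent G := hG.isNilpotent
  refine h.spn.trans (Submodule.span_le.mpr ?_)
  rintro _ ⟨ht, m, g, hm, hg, rfl⟩
  obtain ⟨E, hE, T⟩ := h.tau hΘ m hm
  have h1 := T.spanning hfr ha hα g ((hE g).mpr ⟨hg, ht⟩)
  have h2 : AddSubgroup.closure {t | ∃ y ∈ E, ∃ f ∈ F, (∀ h ∈ H, φ h y = y) ∧ t = X.τ m (φ f y)} ≤
      (Submodule.span K {x | x ∈ M ∧ x ^ e = 0}).toAddSubgroup := by
    rw [AddSubgroup.closure_le]
    rintro _ ⟨y, hy, f, hf, hfix, rfl⟩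
    obtain ⟨h3, h4⟩ := (hE _).mp (T.inv f y hy)
    refine Submodule.subset_span ⟨h4, ?_⟩
    obtain ⟨k, hk⟩ := (IsPGroup.iff_orderOf.mp hG) y
    have h5 : p ^ k ∣ e := by rw [← hk]; exact orderOf_dvd_of_pow_eq_one (he y hfix)
    have h6 : X.τ m (φ f y) ^ (p ^ k) = 0 := by
      refine X.τ_pow m k _ h3 ?_
      rw [← map_pow, ← hk, pow_orderOf_eq_one, map_one]
    exact pow_eq_zero_of_le (Nat.le_of_dvd he0 h5) h6
  have h3 := h2 h1
  rw [← Nat.cast_smul_eq_nsmul K] at h3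
  have h4 : X.τ m g = (Nat.card F : K)⁻¹ • ((Nat.card F : K) • X.τ m g) := by
    rw [smul_smul, inv_mul_cancel₀ hn, one_smul]
  rw [SetLike.mem_coe, h4]
  exact Submodule.smul_mem _ _ h3

lemma Good.mul (hΘ : ∀ w m g, g ∈ X.D m → Θ w (X.τ m g) = X.τ m (φ w g))
    {M : Submodule K A} (h : Good X Θ M) (v w : W) (x : A) (hx : x ∈ M) :
    Θ (v * w) x = Θ v (Θ w x) := by
  replace hx := h.spn hx
  induction hx using Submodule.span_induction with
  | mem x hx =>
    obtain ⟨_, m, g, _, hg, rfl⟩ := hx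
    rw [hΘ _ _ _ hg, hΘ _ _ _ hg, hΘ _ _ _ (X.act_mem _ _ _ hg), map_mul]; rfl
  | zero => simp
  | add x y _ _ h1 h2 => simp only [map_add, h1, h2]
  | smul c x _ h => simp only [map_smul, h]

lemma Good.fix (hΘ : ∀ w m g, g ∈ X.D m → Θ w (X.τ m g) = X.τ m (φ w g))
    {a : W} (ha : Subgroup.zpowers a = F)
    (hα : ∀ x, φ a x = x → x = 1) (hn : (Nat.card F : K) ≠ 0)
    {M : Submodule K A} (h : Good X Θ M) :
    (∀ x ∈ M, ((Θ a)^[Nat.card F]) x = x) ∧ ∀ x ∈ M, Θ a x = x → x = 0 := by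
  classical
  have := Fintype.ofFinite F
  have haF : a ∈ F := by rw [← ha]; exact Subgroup.mem_zpowers a
  have h1 : ∀ x ∈ M, Θ 1 x = x := by
    intro x hx
    replace hx := h.spn hx
    induction hx using Submodule.span_induction with
    | mem x hx =>
      obtain ⟨_, m, g, _, hg, rfl⟩ := hx
      rw [hΘ _ _ _ hg, map_one]; rfl
    | zero => simp
    | add x y _ _ h1 h2 => simp only [map_add, h1, h2]
    | smul c x _ h => simp only [map_smul, h]
  have hit : ∀ j, ∀ x ∈ M, ((Θ a)^[j]) x = Θ (a ^ j) x := by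
    intro j
    induction j with
    | zero => intro x hx; rw [pow_zero, h1 x hx]; rfl
    | succ j ih =>
      intro x hx
      rw [Function.iterate_succ_apply', ih x hx, pow_succ', h.mul hΘ _ _ _ hx]
  have hcard : a ^ Nat.card F = 1 := by
    rw [← ha, Nat.card_zpowers, pow_orderOf_eq_one]
  refine ⟨fun x hx => by rw [hit _ x hx, hcard, h1 x hx], fun x hx hfix => ?_⟩
  have hsum : ∀ x ∈ M, ∑ f : F, Θ f x = 0 := by
    intro x hx
    replace hx := h.spn hx
    induction hx using Submodule.span_induction with
    | mem x hx =>
      obtain ⟨ht, m, g, hm, hg, rfl⟩ := hx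
      obtain ⟨E, hE, T⟩ := h.tau hΘ m hm
      exact T.sumF haF hα g ((hE g).mpr ⟨hg, ht⟩)
    | zero => simp
    | add x y _ _ h1 h2 => simp only [map_add, Finset.sum_add_distrib, h1, h2, add_zero]
    | smul c x _ h => simp only [map_smul, ← Finset.smul_sum, h, smul_zero]
  have hfx : ∀ f : F, Θ f x = x := by
    rintro ⟨f, hf⟩
    rw [← ha, mem_zpowers_iff_mem_range_orderOf] at hf
    obtain ⟨j, _, rfl⟩ := Finset.mem_image.mp hf
    change Θ (a ^ j) x = x
    rw [← hit j x hx]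
    exact Function.iterate_fixed hfix j
  replace hsum := hsum x hx
  rw [Finset.sum_congr rfl (fun f _ => hfx f), Finset.sum_const, Finset.card_univ,
    ← Nat.card_eq_fintype_card, ← Nat.cast_smul_eq_nsmul K] at hsum
  exact (smul_eq_zero.mp hsum).resolve_left hn

lemma good_lgen (hΘ : ∀ w m g, g ∈ X.D m → Θ w (X.τ m g) = X.τ m (φ w g)) :
    Good X Θ (lgen K (Set.range (X.τ 1))) := by
  have hD : ∀ g, g ∈ X.D 1 := fun g => by rw [X.D_one]; trivial
  set M := lgen K (Set.range (X.τ 1)) with hM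
  refine ⟨br_lgen _, ?_, ?_⟩
  · intro w
    have : M ≤ M.comap (Θ w).toLinearMap := by
      refine lgen_le ?_ ?_
      · rintro _ ⟨g, rfl⟩
        change Θ w (X.τ 1 g) ∈ M
        rw [hΘ _ _ _ (hD g)]
        exact subset_lgen _ ⟨_, rfl⟩
      · rw [FrobExp.br_le]
        intro x hx y hy
        change Θ w (x * y - y * x) ∈ M
        rw [map_sub, map_mul, map_mul]
        exact br_lgen _ (mem_br hx hy)
    exact fun x hx => this hx
  · refine lgen_le ?_ ?_
    · rintro _ ⟨g, rfl⟩
      exact Submodule.subset_span ⟨subset_lgen _ ⟨_, rfl⟩, 1, g, le_rfl, hD g, rfl⟩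
    · refine (br_gl_le X M (br_lgen _)).trans (Submodule.span_mono ?_)
      rintro t ⟨h1, h2⟩
      exact ⟨br_lgen _ h1, h2⟩

end Core

theorem core_aux {K A G : Type*} [Field K] [Ring A] [Algebra K A] [Group G] {p : ℕ}
    (X : GrData K A G p) {W : Type*} [Group W] (φ : W →* MulAut G)
    [Finite G] [Finite W] {F H : Subgroup W} [F.Normal] [Fact p.Prime] (hG : IsPGroup p G)
    (hfr : ∀ h ∈ H, h ≠ 1 → ∀ g ∈ F, h * g = g * h → g = 1) {a : W} (ha : Subgroup.zpowers a = F)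
    (hα : ∀ x, φ a x = x → x = 1) (hn : (Nat.card F : K) ≠ 0) {ω : K}
    (hω : IsPrimitiveRoot ω (Nat.card F))
    {e : ℕ} (he0 : 0 < e) (he : ∀ x, (∀ h ∈ H, φ h x = x) → x ^ e = 1)
    (x : G) (hx : Subgroup.closure (Set.range fun w => φ w x) = ⊤) :
    (e = 1 → ∀ g : G, g = 1) ∧
    ∀ q, cb e (2 ^ Nat.card W - 1) (Nat.card W) ≤ p ^ q → ∀ g : G, g ^ (p ^ q) = 1 := by
  classical
  have := Fintype.ofFinite W
  choose Θ hΘ0 using fun w => X.act (φ w)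
  have hΘ : ∀ w m g, g ∈ X.D m → Θ w (X.τ m g) = X.τ m (φ w g) := hΘ0
  have haF : a ∈ F := by rw [← ha]; exact Subgroup.mem_zpowers a
  have hM := good_lgen (X := X) (φ := φ) hΘ
  set M := lgen K (Set.range (X.τ 1)) with hMd
  have hSM : Submodule.span K (Set.range (X.τ 1)) ≤ M := Submodule.span_le.mpr (subset_lgen _)
  have hD : ∀ g, g ∈ X.D 1 := fun g => by rw [X.D_one]; trivial
  refine ⟨fun he1 g => ?_, fun q hq => ?_⟩
  · have h1 := hM.nil hΘ hG hfr haF hα hn he0 he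
    have h2 : M = ⊥ := by
      rw [← le_bot_iff]
      refine h1.trans (Submodule.span_le.mpr ?_)
      rintro t ⟨_, ht⟩
      rw [he1, pow_one] at ht
      exact ht
    have := X.nilp 1 0 (by rw [pow_one, ← le_bot_iff, ← h2]; exact hSM) (by simp) g
    simpa using this
  · refine X.nilp _ q ?_ hq
    have hF : NeZero (Nat.card F) := ⟨Nat.card_pos.ne'⟩
    obtain ⟨h1, h2⟩ := hM.fix hΘ ha hα hn
    have h3 := br_iter_bot hω hn (Θ a) M hM.br_le (hM.inv a) h1 h2 (Nat.card W)
      (Nat.le_of_dvd Nat.card_pos F.card_subgroup_dvd_card)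
    have h4 := nil_bound e (Good X Θ) (fun M h => h.br) (fun M h => h.br_le)
      (fun M h => h.nil hΘ hG hfr haF hα hn he0 he) _ (Nat.card W) M hM h3
      ⟨Finset.univ.image (fun w => X.τ 1 (φ w x)),
        Finset.card_image_le.trans (by rw [Finset.card_univ, Nat.card_eq_fintype_card]), by
        refine (lgen_le_sup _).trans (sup_le_sup ?_ le_rfl)
        rw [Submodule.span_le]
        rintro _ ⟨g, rfl⟩
        have hg : g ∈ Subgroup.closure (Set.range fun w => φ w x) := by rw [hx]; trivial
        induction hg using Subgroup.closure_induction with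
        | mem g hg =>
          obtain ⟨w, rfl⟩ := hg
          refine Submodule.subset_span ?_
          simp only [Finset.coe_image, Finset.coe_univ, Set.image_univ]
          exact ⟨w, rfl⟩
        | one => rw [X.τ_one 1 le_rfl]; exact zero_mem _
        | mul g h _ _ h1 h2 =>
          rw [X.τ_mul 1 g h le_rfl (hD g) (hD h)]; exact add_mem h1 h2
        | inv g _ h1 => rw [X.τ_inv 1 le_rfl g (hD g)]; exact neg_mem h1⟩
    rw [← le_bot_iff, ← h4]
    exact pow_le_pow_left' hSM _

theorem core {G : Type*} [Group G] {p : ℕ} {W : Type*} [Group W] (φ : W →* MulAut G)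
    [Finite G] [Finite W] {F H : Subgroup W} [F.Normal] [Fact p.Prime] (hG : IsPGroup p G)
    (hfr : ∀ h ∈ H, h ≠ 1 → ∀ g ∈ F, h * g = g * h → g = 1) {a : W} (ha : Subgroup.zpowers a = F)
    (hα : ∀ x, φ a x = x → x = 1) (hn : ¬ p ∣ Nat.card F)
    {e : ℕ} (he0 : 0 < e) (he : ∀ x, (∀ h ∈ H, φ h x = x) → x ^ e = 1)
    (x : G) (hx : Subgroup.closure (Set.range fun w => φ w x) = ⊤) :
    (e = 1 → ∀ g : G, g = 1) ∧
    ∀ q, cb e (2 ^ Nat.card W - 1) (Nat.card W) ≤ p ^ q → ∀ g : G, g ^ (p ^ q) = 1 := by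
  set n := Nat.card F with hnd
  have hF : NeZero n := ⟨Nat.card_pos.ne'⟩
  have hn1 : ((n : ℕ) : ZMod p) ≠ 0 := by rwa [Ne, ZMod.natCast_eq_zero_iff]
  have : NeZero ((n : ℕ) : ZMod p) := ⟨hn1⟩
  let K := CyclotomicField n (ZMod p)
  have : CharP K p := charP_of_injective_algebraMap (algebraMap (ZMod p) K).injective p
  have hn2 : ((n : ℕ) : K) ≠ 0 := by
    rw [Ne, CharP.cast_eq_zero_iff K p]; exact hn
  exact core_aux (grData K p hG) φ hG hfr ha hα hn2 (IsCyclotomicExtension.zeta_spec n (ZMod p) K)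
    he0 he x hx

end FrobExp

namespace FrobExp

section Red

open scoped Pointwise

variable {W G : Type*} [Group W] [Group G]

/-- Restriction of an action to an invariant subgroup. -/
def restr (φ : W →* MulAut G) (Q : Subgroup G) (hQ : ∀ w, ∀ x ∈ Q, φ w x ∈ Q) : W →* MulAut Q where
  toFun w :=
    { toFun := fun x => ⟨φ w x, hQ w x x.2⟩
      invFun := fun x => ⟨φ w⁻¹ x, hQ w⁻¹ x x.2⟩
      left_inv := fun x => Subtype.ext (by simp)
      right_inv := fun x => Subtype.ext (by simp)
      map_mul' := fun x y => Subtype.ext (by simp) }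
  map_one' := by ext x; simp
  map_mul' v w := by ext x; simp

lemma restr_apply (φ : W →* MulAut G) (Q : Subgroup G) (hQ : ∀ w, ∀ x ∈ Q, φ w x ∈ Q) (w : W)
    (x : Q) : ((restr φ Q hQ w x : Q) : G) = φ w x := rfl

lemma fix_pow (φ : W →* MulAut G) (a : W) (x : G) (h : φ a x = x) (j : ℕ) : φ (a ^ j) x = x := by
  induction j with
  | zero => simp
  | succ j ih => rw [pow_succ, map_mul, MulAut.mul_apply, h, ih]

theorem pgroup_case {p : ℕ} [hp : Fact p.Prime] (φ : W →* MulAut G)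
    [Finite G] [Finite W] {F H : Subgroup W} [hFn : F.Normal] (hG : IsPGroup p G)
    (hfr : ∀ h ∈ H, h ≠ 1 → ∀ g ∈ F, h * g = g * h → g = 1) {a : W} (ha : Subgroup.zpowers a = F)
    (hα : ∀ x, φ a x = x → x = 1)
    {e : ℕ} (he0 : 0 < e) (he : ∀ x, (∀ h ∈ H, φ h x = x) → x ^ e = 1) (x : G) :
    x ^ (e ^ (cb e (2 ^ Nat.card W - 1) (Nat.card W))) = 1 := by
  classical
  have haF : a ∈ F := by rw [← ha]; exact Subgroup.mem_zpowers a
  obtain ⟨k, n', hn', hk⟩ := Nat.exists_eq_pow_mul_and_not_dvd (orderOf_pos a).ne' p hp.out.ne_one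
  set b := a ^ (p ^ k) with hb
  have hbo : orderOf b = n' := by
    rw [hb, orderOf_pow, hk, Nat.gcd_mul_right_left, Nat.mul_div_cancel_left _ (pow_pos hp.out.pos k)]
  set F' := Subgroup.zpowers b with hF'
  have hF'F : F' ≤ F := by
    rw [hF', Subgroup.zpowers_le]; exact F.pow_mem haF _
  have hF'n : F'.Normal := by
    refine ⟨fun f hf w => ?_⟩
    obtain ⟨j, rfl⟩ := Subgroup.mem_zpowers_iff.mp hf
    have h1 := hFn.conj_mem a haF w
    rw [← ha] at h1
    obtain ⟨i, hi⟩ := Subgroup.mem_zpowers_iff.mp h1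
    have h2 : w * b * w⁻¹ = b ^ i := by
      rw [hb, ← conj_pow, ← hi, ← zpow_natCast, ← zpow_natCast, ← zpow_mul, ← zpow_mul, mul_comm]
    rw [← conj_zpow, h2]
    exact F'.zpow_mem (F'.zpow_mem (Subgroup.mem_zpowers b) _) _
  have hβ : ∀ y, φ b y = y → y = 1 := by
    let C : Subgroup G :=
      { carrier := {y | φ b y = y}
        one_mem' := map_one _
        mul_mem' := fun {y z} hy hz => by
          change φ b (y * z) = y * z
          rw [map_mul]; exact congrArg₂ _ hy hz
        inv_mem' := fun {y} hy => by
          change φ b y⁻¹ = y⁻¹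
          rw [map_inv]; exact congrArg _ hy }
    have hC : ∀ y, y ∈ C ↔ φ b y = y := fun y => Iff.rfl
    by_contra! hcon
    obtain ⟨y, hy, hy1⟩ := hcon
    have hyC : y ∈ C := (hC y).mpr hy
    have hCinv : ∀ j : ℕ, ∀ z ∈ C, φ (a ^ j) z ∈ C := by
      intro j z hz
      rw [hC] at hz ⊢
      have : b * a ^ j = a ^ j * b := by rw [hb, ← pow_add, ← pow_add, add_comm]
      rw [← MulAut.mul_apply, ← map_mul, this, map_mul, MulAut.mul_apply, hz]
    have hainv : ∀ z ∈ C, φ a⁻¹ z ∈ C := by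
      intro z hz
      have : a⁻¹ = a ^ (orderOf a - 1) := by
        rw [inv_eq_iff_mul_eq_one, ← pow_succ', Nat.sub_add_cancel (orderOf_pos a), pow_orderOf_eq_one]
      rw [this]; exact hCinv _ z hz
    have hainv1 : ∀ z ∈ C, φ a z ∈ C := by
      intro z hz
      have := hCinv 1 z hz
      rwa [pow_one] at this
    let σ : Equiv.Perm C :=
      { toFun := fun z => ⟨φ a z, hainv1 z z.2⟩
        invFun := fun z => ⟨φ a⁻¹ z, hainv z z.2⟩
        left_inv := fun z => Subtype.ext (by simp)
        right_inv := fun z => Subtype.ext (by simp) }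
    have hσ : ∀ j : ℕ, ∀ z : C, ((σ ^ j) z : G) = φ (a ^ j) z := by
      intro j
      induction j with
      | zero => intro z; simp
      | succ j ih =>
        intro z
        rw [pow_succ, Equiv.Perm.mul_apply, ih, pow_succ, map_mul]; rfl
    have hσp : σ ^ p ^ k = 1 := by
      ext z
      rw [hσ]
      exact (hC z).mp z.2
    have := Fintype.ofFinite C
    have hdvd : p ∣ Fintype.card C := by
      obtain ⟨t, ht⟩ := IsPGroup.iff_card.mp (hG.to_subgroup C)
      rw [Nat.card_eq_fintype_card] at ht
      rw [ht]
      refine dvd_pow_self p ?_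
      rintro rfl
      rw [pow_zero, Fintype.card_eq_one_iff] at ht
      obtain ⟨u, hu⟩ := ht
      exact hy1 (congrArg Subtype.val ((hu ⟨y, hyC⟩).trans (hu 1).symm))
    obtain ⟨z, hz, hz1⟩ := Equiv.Perm.exists_fixed_point_of_prime' hdvd hσp (a := (1 : C))
      (Subtype.ext (by simp [σ]))
    exact hz1 (Subtype.ext (hα z (congrArg Subtype.val hz)))
  -- the subgroup generated by the orbit
  set Q := Subgroup.closure (Set.range fun w => φ w x) with hQ
  have hQinv : ∀ w, ∀ y ∈ Q, φ w y ∈ Q := by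
    intro w
    have : Q ≤ Q.comap (φ w).toMonoidHom := by
      rw [hQ, Subgroup.closure_le]
      rintro _ ⟨v, rfl⟩
      refine Subgroup.subset_closure ⟨w * v, ?_⟩
      simp
    exact fun y hy => this hy
  have hxQ : x ∈ Q := Subgroup.subset_closure ⟨1, by simp⟩
  let φ' := restr φ Q hQinv
  have hcl : Subgroup.closure (Set.range fun w => φ' w ⟨x, hxQ⟩) = ⊤ := by
    rw [← Subgroup.closure_closure_coe_preimage (k := Set.range fun w => φ w x)]
    congr 1
    ext y
    constructor
    · rintro ⟨w, rfl⟩; exact ⟨w, rfl⟩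
    · rintro ⟨w, hw⟩; exact ⟨w, Subtype.ext hw⟩
  have hcard : ¬ p ∣ Nat.card F' := by rw [hF', Nat.card_zpowers, hbo]; exact hn'
  have hfr' : ∀ h ∈ H, h ≠ 1 → ∀ g ∈ F', h * g = g * h → g = 1 :=
    fun h hh h1 g hg => hfr h hh h1 g (hF'F hg)
  have hβ' : ∀ y, φ' b y = y → y = 1 := fun y hy => Subtype.ext (hβ y (congrArg Subtype.val hy))
  have he' : ∀ y : Q, (∀ h ∈ H, φ' h y = y) → y ^ e = 1 := fun y hy =>
    Subtype.ext (he y fun h hh => congrArg Subtype.val (hy h hh))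
  by_cases hpe : p ∣ e
  · have := (core φ' (hG.to_subgroup Q) hfr' rfl hβ' hcard he0 he' ⟨x, hxQ⟩ hcl).2
      (cb e (2 ^ Nat.card W - 1) (Nat.card W)) (Nat.lt_pow_self hp.out.one_lt).le ⟨x, hxQ⟩
    have h2 := congrArg Subtype.val this
    simp only [Subgroup.coe_pow, Subgroup.coe_one] at h2
    obtain ⟨t, ht⟩ := pow_dvd_pow_of_dvd hpe (cb e (2 ^ Nat.card W - 1) (Nat.card W))
    rw [ht, pow_mul, h2, one_pow]
  · have he1 : ∀ y : Q, (∀ h ∈ H, φ' h y = y) → y ^ 1 = 1 := by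
      intro y hy
      have h1 := orderOf_dvd_of_pow_eq_one (he' y hy)
      obtain ⟨j, hj⟩ := (IsPGroup.iff_orderOf.mp (hG.to_subgroup Q)) y
      rw [hj] at h1
      have hj0 : j = 0 := by
        by_contra hj0
        exact hpe ((dvd_pow_self p hj0).trans h1)
      rw [hj0, pow_zero, orderOf_eq_one_iff] at hj
      rw [hj, one_pow]
    have := (core φ' (hG.to_subgroup Q) hfr' rfl hβ' hcard one_pos he1 ⟨x, hxQ⟩ hcl).1 rfl ⟨x, hxQ⟩
    have h2 : x = 1 := congrArg Subtype.val this
    rw [h2, one_pow]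

lemma conj_smul_comm (p : ℕ) (α : MulAut G) (g : G) (P : Sylow p G) :
    α • (MulAut.conj g • P) = MulAut.conj (α g) • (α • P) := by
  rw [smul_smul, smul_smul]
  congr 1
  ext x
  simp

theorem inv_sylow [Finite G] (p : ℕ) [Fact p.Prime] (φ : W →* MulAut G) [Finite W]
    {F : Subgroup W} [hFn : F.Normal] {a : W} (ha : Subgroup.zpowers a = F)
    (hα : ∀ x, φ a x = x → x = 1) :
    ∃ P : Sylow p G, ∀ w, φ w • P = P := by
  have haF : a ∈ F := by rw [← ha]; exact Subgroup.mem_zpowers a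
  set α := φ a with hαd
  have uniq : ∀ P Q : Sylow p G, α • P = P → α • Q = Q → P = Q := by
    intro P Q hP hQ
    obtain ⟨x, hx⟩ := MulAction.exists_smul_eq G P Q
    have hx : MulAut.conj x • P = Q := hx
    have h1 : MulAut.conj (α x) • P = MulAut.conj x • P := by
      have := conj_smul_comm p α x P
      rw [hx, hQ, hP, ← hx] at this
      exact this.symm
    have hxN : x ∈ MulAction.stabilizer G P := by
      refine fpf_mem α hα _ ?_ x ?_
      · intro n hn
        rw [MulAction.mem_stabilizer_iff] at hn ⊢
        have hn : MulAut.conj n • P = P := hn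
        change MulAut.conj (α n) • P = P
        have := conj_smul_comm p α n P
        rw [hn, hP] at this
        exact this.symm
      · rw [MulAction.mem_stabilizer_iff, mul_smul, inv_smul_eq_iff]
        exact h1
    rw [← hx]
    exact (MulAction.mem_stabilizer_iff.mp hxN).symm
  obtain ⟨P0⟩ : Nonempty (Sylow p G) := inferInstance
  obtain ⟨g, hg⟩ := MulAction.exists_smul_eq G P0 (α • P0)
  replace hg : MulAut.conj g • P0 = α • P0 := hg
  obtain ⟨y, hy⟩ : ∃ y, y⁻¹ * α y = g⁻¹ := by
    have inj : Function.Injective (fun n : G => n⁻¹ * α n) := by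
      intro n m h
      have : α (m * n⁻¹) = m * n⁻¹ := by
        have h2 : α n = n * (m⁻¹ * α m) := by
          have h : n⁻¹ * α n = m⁻¹ * α m := h
          rw [← h]; group
        rw [map_mul, map_inv, h2]; group
      have := hα _ this
      rw [mul_inv_eq_one] at this
      exact this.symm
    exact Finite.surjective_of_injective inj g⁻¹
  have hP : α • (MulAut.conj y • P0) = MulAut.conj y • P0 := by
    rw [conj_smul_comm, ← hg, smul_smul, ← map_mul]
    congr 2
    rw [inv_mul_eq_iff_eq_mul] at hy
    rw [hy]; group
  refine ⟨MulAut.conj y • P0, fun w => ?_⟩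
  set P := MulAut.conj y • P0
  refine (uniq _ _ hP ?_).symm
  have h1 := hFn.conj_mem a haF w⁻¹
  rw [← ha, inv_inv] at h1
  obtain ⟨i, hi⟩ := Subgroup.mem_zpowers_iff.mp h1
  have h2 : a * w = w * a ^ i := by rw [hi]; group
  have h3 : (φ (a ^ i)) • P = P := by
    have : α ∈ MulAction.stabilizer (MulAut G) P := hP
    have := (MulAction.stabilizer (MulAut G) P).zpow_mem this i
    rw [map_zpow]; exact this
  rw [smul_smul, hαd, ← map_mul, h2, map_mul, mul_smul, h3]

end Red

theorem main_pow {W G : Type*} [Group W] [Group G] [Finite W] [Finite G] (φ : W →* MulAut G)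
    {F H : Subgroup W} [hFn : F.Normal] 
    (hfr : ∀ h ∈ H, h ≠ 1 → ∀ g ∈ F, h * g = g * h → g = 1) (hcyc : IsCyclic F)
    (hF : ∀ x : G, (∀ g ∈ F, φ g x = x) → x = 1)
    {e : ℕ} (he0 : 0 < e) (he : ∀ x, (∀ h ∈ H, φ h x = x) → x ^ e = 1) (x : G) :
    x ^ (e ^ (cb e (2 ^ Nat.card W - 1) (Nat.card W))) = 1 := by
  classical
  set c := cb e (2 ^ Nat.card W - 1) (Nat.card W) with hc
  obtain ⟨a, ha⟩ : ∃ a : W, Subgroup.zpowers a = F := (Subgroup.isCyclic_iff_exists_zpowers_eq_top F).mp hcyc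
  have hα : ∀ x, φ a x = x → x = 1 := by
    intro x hx
    refine hF x fun f hf => ?_
    rw [← ha, mem_zpowers_iff_mem_range_orderOf] at hf
    obtain ⟨j, _, rfl⟩ := Finset.mem_image.mp hf
    exact fix_pow φ a x hx j
  refine orderOf_dvd_iff_pow_eq_one.mp ((Nat.dvd_iff_prime_pow_dvd_dvd _ _).mpr ?_)
  intro p k hp hk
  have : Fact p.Prime := ⟨hp⟩
  obtain ⟨P, hP⟩ := inv_sylow p φ ha hα
  set y := x ^ (orderOf x / p ^ k) with hy
  have hyo : orderOf y = p ^ k := orderOf_pow_orderOf_div (orderOf_pos x).ne' hk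
  have hyp : IsPGroup p (Subgroup.zpowers y) := IsPGroup.of_card (by rw [Nat.card_zpowers, hyo])
  obtain ⟨Q, hQ⟩ := hyp.exists_le_sylow
  obtain ⟨g, hg⟩ := MulAction.exists_smul_eq G Q P
  have hyP : g * y * g⁻¹ ∈ (P : Subgroup G) := by
    rw [← hg, Sylow.coe_subgroup_smul]
    have : y ∈ (Q : Subgroup G) := hQ (Subgroup.mem_zpowers y)
    have := Subgroup.smul_mem_pointwise_smul y (MulAut.conj g) (Q : Subgroup G) this
    exact this
  have hPinv : ∀ w, ∀ z ∈ (P : Subgroup G), φ w z ∈ (P : Subgroup G) := by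
    intro w z hz
    have := Subgroup.smul_mem_pointwise_smul z (φ w) (P : Subgroup G) hz
    rw [← Sylow.pointwise_smul_def, hP w] at this
    exact this
  have h1 := pgroup_case (restr φ P hPinv) P.isPGroup' hfr ha
    (fun z hz => Subtype.ext (hα z (congrArg Subtype.val hz))) he0
    (fun z hz => Subtype.ext (he z fun h hh => congrArg Subtype.val (hz h hh)))
    ⟨_, hyP⟩
  have h2 := congrArg Subtype.val h1
  simp only [Subgroup.coe_pow, Subgroup.coe_one] at h2
  rw [conj_pow, conj_eq_one_iff] at h2
  rw [← hyo]
  exact orderOf_dvd_of_pow_eq_one h2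

end FrobExp

/-- **Theorem (Khukhro–Makarenko–Shumyatsky).**
There is a function `f : ℕ × ℕ → ℕ` such that whenever a Frobenius group `W = FH`
with cyclic kernel `F` and complement `H` acts by automorphisms on a finite group
`G` with `C_G(F) = 1` and `C_G(H)` of exponent dividing `e > 0`, the exponent of
`G` is at most `f (e, |FH|)`. -/
theorem exponent_bounded_of_frobenius_cyclic_kernel_action :
    ∃ f : ℕ × ℕ → ℕ,
      ∀ (W : Type) [Group W] [Finite W] (F H : Subgroup W),
        F.Normal → F ⊓ H = ⊥ → F ⊔ H = ⊤ →
        (∀ h ∈ H, h ≠ 1 → ∀ g ∈ F, h * g = g * h → g = 1) →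
        IsCyclic F →
      ∀ (G : Type) [Group G] [Finite G] (φ : W →* MulAut G),
        (∀ x : G, (∀ g ∈ F, φ g x = x) → x = 1) →
        ∀ (e : ℕ), 0 < e →
        (∀ x : G, (∀ h ∈ H, φ h x = x) → x ^ e = 1) →
        Monoid.exponent G ≤ f (e, Nat.card W) := by
  refine ⟨fun q => q.1 ^ (FrobExp.cb q.1 (2 ^ q.2 - 1) q.2), ?_⟩
  intro W _ _ F H hFn _ _ hfr hcyc G _ _ φ hF e he0 he
  have := hFn
  exact Nat.le_of_dvd (pow_pos he0 _) (Monoid.exponent_dvd_of_forall_pow_eq_one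
    (fun x => FrobExp.main_pow φ hfr hcyc hF he0 he x))
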